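/- For every odd prime q and ε ∈ (0,1) there exists a constant C_{ε,q} such that the following holds. Fix an integer A with 1/ε ≤ A ≤ 2/ε; let R = q^{2m} (m ∈ ℕ) be sufficiently large, let r ∈ 4ℕ satisfy q^{q^{A(r−4)}} ≤ R < q^{q^{Ar}}, set R_k := q^{kr}, and let N ∈ ℕ satisfy q^{Nr} ≤ R < q^{(N+1)r}. Let J ∈ {1,…,N} and let f : ℚ_q² → ℂ be a Schwartz function with Fourier support in Ξ_{1/R_J}. Then ∫_{ℚ_q²} max_{τ₁ ≠ τ₁'} |f_{τ₁} f_{τ₁'}|³ dμ² ≤ C_{ε,q} (log R)^{9+6ε} (∑_{τ_J} ‖f_{τ_J}‖_{L∞(ℚ_q²)}²)² (∑_{τ_J} ∫_{ℚ_q²} |f_{τ_J}|² dμ²), where τ₁, τ₁' range over intervals of length R₁^{-1/2} = q^{-r/2} in ℤ_q and τ_J over intervals of length R_J^{-1/2} in ℤ_q. -/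

import Mathlib

open MeasureTheory

noncomputable instance (q : ℕ) [Fact q.Prime] : MeasurableSpace ℚ_[q] := borel _
instance (q : ℕ) [Fact q.Prime] : BorelSpace ℚ_[q] := ⟨rfl⟩

/-- The Fourier transform on `ℚ_q²` with respect to the additive character `χ`
and the Haar measure `μ`. -/
noncomputable def qpFourier (q : ℕ) [Fact q.Prime] (μ : Measure ℚ_[q]) [SigmaFinite μ]
    (χ : ℚ_[q] → ℂ) (F : ℚ_[q] × ℚ_[q] → ℂ) (ξη : ℚ_[q] × ℚ_[q]) : ℂ :=
  ∫ x, F x * χ (-(ξη.1 * x.1 + ξη.2 * x.2)) ∂(μ.prod μ)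

/-- The Fourier projection `F_τ` of `F` to the frequency strip `τ × ℚ_q`. -/
noncomputable def qpProj (q : ℕ) [Fact q.Prime] (μ : Measure ℚ_[q]) [SigmaFinite μ]
    (χ : ℚ_[q] → ℂ) (F : ℚ_[q] × ℚ_[q] → ℂ) (τ : Set ℚ_[q]) (x : ℚ_[q] × ℚ_[q]) : ℂ :=
  ∫ ξη in τ ×ˢ (Set.univ : Set ℚ_[q]),
    qpFourier q μ χ F ξη * χ (ξη.1 * x.1 + ξη.2 * x.2) ∂(μ.prod μ)

/-- The interval `{ξ ∈ ℤ_q : |ξ - a| ≤ q^{-ℓ}}`; as `a` runs over `0, …, q^ℓ - 1` these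
enumerate all intervals of length `q^{-ℓ}` inside `ℤ_q`. -/
def qpItv (q : ℕ) [Fact q.Prime] (ℓ a : ℕ) : Set ℚ_[q] :=
  {ξ : ℚ_[q] | ‖ξ - (a : ℚ_[q])‖ ≤ (q : ℝ) ^ (-(ℓ : ℤ))}

open scoped Classical in
/-- Indices `b < q^{ℓ'}` whose associated interval of length `q^{-ℓ'}` is contained in the
interval `qpItv q ℓ a` (equivalently, whose centre lies in it). -/
noncomputable def qpSubItv (q : ℕ) [Fact q.Prime] (ℓ' ℓ a : ℕ) : Finset ℕ :=
  (Finset.range (q ^ ℓ')).filter (fun b => (b : ℚ_[q]) ∈ qpItv q ℓ a)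

/-! ### Basic facts on the character and on `q`-adic norms -/

/-- The hypotheses on the additive character. -/
structure QChr (q : ℕ) [Fact q.Prime] (χ : ℚ_[q] → ℂ) : Prop where
  mul : ∀ x y, χ (x + y) = χ x * χ y
  norm : ∀ x, ‖χ x‖ = 1
  triv : ∀ x, ‖x‖ ≤ 1 → χ x = 1
  nontriv : ∃ x, ‖x‖ ≤ (q : ℝ) ∧ χ x ≠ 1

section basic
variable {q : ℕ} [Fact q.Prime] {χ : ℚ_[q] → ℂ}

theorem QChr.zero (h : QChr q χ) : χ 0 = 1 := h.triv 0 (by simp)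

theorem QChr.ne_zero (h : QChr q χ) (x : ℚ_[q]) : χ x ≠ 0 := by
  intro h0
  have := h.norm x
  rw [h0] at this
  simp at this

theorem QChr.conj (h : QChr q χ) (x : ℚ_[q]) : (starRingEnd ℂ) (χ x) = χ (-x) := by
  have h1 : χ x * χ (-x) = 1 := by rw [← h.mul]; simp [h.zero]
  have h2 : χ x * (starRingEnd ℂ) (χ x) = 1 := by
    rw [Complex.mul_conj']
    simp [h.norm]
  exact mul_left_cancel₀ (h.ne_zero x) (h2.trans h1.symm)

theorem QChr.congr (h : QChr q χ) {x y : ℚ_[q]} (hxy : ‖x - y‖ ≤ 1) : χ x = χ y := by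
  have : x = y + (x - y) := by ring
  rw [this, h.mul, h.triv _ hxy, mul_one]

theorem q_pos : (0 : ℝ) < (q : ℝ) := by
  exact_mod_cast (Fact.out : q.Prime).pos

theorem q_one_lt : (1 : ℝ) < (q : ℝ) := by
  exact_mod_cast (Fact.out : q.Prime).one_lt

theorem norm_ge_of_gt {z : ℚ_[q]} {k : ℕ} (hz : ((q : ℝ) ^ k)⁻¹ < ‖z‖) :
    (q : ℝ) * ((q : ℝ) ^ k)⁻¹ ≤ ‖z‖ := by
  by_contra hcon
  push Not at hcon
  have := (Padic.norm_le_pow_iff_norm_lt_pow_add_one z (-(k : ℤ))).2 (by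
    rw [zpow_add₀ q_pos.ne', zpow_neg, zpow_natCast, zpow_one, mul_comm]
    exact hcon)
  rw [zpow_neg, zpow_natCast] at this
  linarith

/-- A frequency `z` with `|z| > q^{-k}` is detected by some `t` with `|t| ≤ q^k`. -/
theorem QChr.detect (h : QChr q χ) {z : ℚ_[q]} {k : ℕ} (hz : ((q : ℝ) ^ k)⁻¹ < ‖z‖) :
    ∃ t : ℚ_[q], ‖t‖ ≤ (q : ℝ) ^ k ∧ χ (z * t) ≠ 1 := by
  obtain ⟨x0, hx0, hne⟩ := h.nontriv
  have hq := q_pos (q := q)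
  have hk : 0 < (q : ℝ) ^ k := by positivity
  have hz0 : 0 < ‖z‖ := lt_trans (by positivity) hz
  have hzne : z ≠ 0 := norm_pos_iff.1 hz0
  refine ⟨x0 / z, ?_, ?_⟩
  · rw [norm_div, div_le_iff₀ hz0]
    have := norm_ge_of_gt hz
    calc ‖x0‖ ≤ q := hx0
      _ = (q : ℝ) ^ k * ((q : ℝ) * ((q : ℝ) ^ k)⁻¹) := by field_simp
      _ ≤ _ := by gcongr
  · rwa [mul_div_cancel₀ _ hzne]

theorem norm_sub_le_iff (a b l : ℕ) :
    ‖(b : ℚ_[q]) - (a : ℚ_[q])‖ ≤ ((q : ℝ) ^ l)⁻¹ ↔ b % q ^ l = a % q ^ l := by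
  have h1 := Padic.norm_int_le_pow_iff_dvd (p := q) ((b : ℤ) - (a : ℤ)) l
  rw [zpow_neg, zpow_natCast] at h1
  push_cast at h1
  rw [h1]
  have : (q : ℤ) ^ l = ((q ^ l : ℕ) : ℤ) := by push_cast; rfl
  rw [this, ← Nat.modEq_iff_dvd]
  exact ⟨fun h => h.symm, fun h => h.symm⟩

theorem norm_sub_gt_of_ne {a b l : ℕ} (ha : a < q ^ l) (hb : b < q ^ l) (hab : a ≠ b) :
    ((q : ℝ) ^ l)⁻¹ < ‖(b : ℚ_[q]) - (a : ℚ_[q])‖ := by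
  by_contra hcon
  push Not at hcon
  rw [norm_sub_le_iff, Nat.mod_eq_of_lt ha, Nat.mod_eq_of_lt hb] at hcon
  exact hab hcon.symm

theorem norm_two (hq2 : q ≠ 2) : ‖(2 : ℚ_[q])‖ = 1 := by
  have h : ¬ ‖((2 : ℤ) : ℚ_[q])‖ < 1 := by
    rw [Padic.norm_intCast_lt_one_iff]
    intro hd
    have h2 : q ∣ 2 := by exact_mod_cast hd
    exact hq2 ((Nat.prime_dvd_prime_iff_eq Fact.out Nat.prime_two).1 h2)
  have h' := Padic.norm_int_le_one (p := q) 2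
  push_cast at h h'
  exact le_antisymm h' (not_lt.1 h)

theorem nonarch2 {x y : ℚ_[q]} {c : ℝ} (hx : ‖x‖ ≤ c) (hy : ‖y‖ ≤ c) : ‖x + y‖ ≤ c :=
  (Padic.nonarchimedean x y).trans (max_le hx hy)

/-! ### Nice functions -/

/-- Locally constant functions with compact support. -/
def QNice {E : Type*} [Zero E] (F : ℚ_[q] × ℚ_[q] → E) : Prop :=
  IsLocallyConstant F ∧ HasCompactSupport F

theorem QNice.comp {E E' : Type*} [Zero E] [Zero E'] {F : ℚ_[q] × ℚ_[q] → E} (h : QNice F)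
    (φ : E → E') (h0 : φ 0 = 0) : QNice (fun x => φ (F x)) :=
  ⟨h.1.comp φ, h.2.comp_left h0⟩

theorem QNice.comp2 {E E' E'' : Type*} [Zero E] [Zero E'] [Zero E'']
    {F : ℚ_[q] × ℚ_[q] → E} {G : ℚ_[q] × ℚ_[q] → E'} (h : QNice F) (h' : QNice G)
    (φ : E → E' → E'') (h0 : φ 0 0 = 0) : QNice (fun x => φ (F x) (G x)) :=
  ⟨h.1.comp₂ h'.1 φ, h.2.comp₂_left h'.2 h0⟩

theorem QNice.lmul {E : Type*} [MulZeroClass E] {F w : ℚ_[q] × ℚ_[q] → E}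
    (hw : IsLocallyConstant w) (h : QNice F) : QNice (fun x => w x * F x) :=
  ⟨hw.comp₂ h.1 (fun a b => a * b), h.2.mul_left⟩

theorem QNice.zero {E : Type*} [Zero E] : QNice (fun _ : ℚ_[q] × ℚ_[q] => (0 : E)) :=
  ⟨IsLocallyConstant.const 0, HasCompactSupport.zero⟩

theorem QNice.add {E : Type*} [AddZeroClass E] {F G : ℚ_[q] × ℚ_[q] → E} (h : QNice F)
    (h' : QNice G) : QNice (fun x => F x + G x) := h.comp2 h' (· + ·) (add_zero 0)

theorem QNice.mul {E : Type*} [MulZeroClass E] {F G : ℚ_[q] × ℚ_[q] → E} (h : QNice F)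
    (h' : QNice G) : QNice (fun x => F x * G x) := h.comp2 h' (· * ·) (mul_zero 0)

theorem QNice.cmul {E : Type*} [MulZeroClass E] {F : ℚ_[q] × ℚ_[q] → E} (c : E) (h : QNice F) :
    QNice (fun x => c * F x) := h.comp (c * ·) (mul_zero c)

theorem QNice.sum {E ι : Type*} [AddCommMonoid E] (s : Finset ι) {F : ι → ℚ_[q] × ℚ_[q] → E}
    (h : ∀ i ∈ s, QNice (F i)) : QNice (fun x => ∑ i ∈ s, F i x) := by
  classical
  induction s using Finset.induction_on with
  | empty => simpa using QNice.zero
  | insert a s ha ih =>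
    simp only [Finset.sum_insert ha]
    exact (h a (Finset.mem_insert_self a s)).add
      (ih (fun i hi => h i (Finset.mem_insert_of_mem hi)))

theorem QNice.conj {F : ℚ_[q] × ℚ_[q] → ℂ} (h : QNice F) :
    QNice (fun x => (starRingEnd ℂ) (F x)) := h.comp _ (map_zero _)

theorem QNice.npow {F : ℚ_[q] × ℚ_[q] → ℂ} (h : QNice F) {n : ℕ} (hn : n ≠ 0) :
    QNice (fun x => ‖F x‖ ^ n) := h.comp (fun z => ‖z‖ ^ n) (by simp [hn])

theorem QNice.int {E : Type*} [NormedAddCommGroup E] {F : ℚ_[q] × ℚ_[q] → E} (h : QNice F)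
    (ν : Measure (ℚ_[q] × ℚ_[q])) [ν.IsAddHaarMeasure] : Integrable F ν :=
  h.1.continuous.integrable_of_hasCompactSupport h.2

/-! ### Orthogonality -/

theorem integral_eq_zero_of_translate (ν : Measure (ℚ_[q] × ℚ_[q])) [ν.IsAddHaarMeasure]
    {Φ : ℚ_[q] × ℚ_[q] → ℂ} (t : ℚ_[q] × ℚ_[q]) (ζ : ℂ) (hζ : ζ ≠ 1)
    (h : ∀ x, Φ (x + t) = ζ * Φ x) : ∫ x, Φ x ∂ν = 0 := by
  have h1 : ∫ x, Φ (x + t) ∂ν = ∫ x, Φ x ∂ν := integral_add_right_eq_self Φ t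
  simp only [h] at h1
  rw [integral_const_mul] at h1
  have h2 : (ζ - 1) * ∫ x, Φ x ∂ν = 0 := by rw [sub_mul, h1]; ring
  rcases mul_eq_zero.1 h2 with h3 | h3
  · exact absurd (sub_eq_zero.1 h3) hζ
  · exact h3

theorem orth_sum {ι : Type*} (ν : Measure (ℚ_[q] × ℚ_[q])) [ν.IsAddHaarMeasure] (s : Finset ι)
    (φ : ι → ℚ_[q] × ℚ_[q] → ℂ) (hn : ∀ i ∈ s, QNice (φ i))
    (ho : ∀ i ∈ s, ∀ j ∈ s, i ≠ j → ∫ x, φ i x * (starRingEnd ℂ) (φ j x) ∂ν = 0) :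
    ∫ x, ‖∑ i ∈ s, φ i x‖ ^ 2 ∂ν = ∑ i ∈ s, ∫ x, ‖φ i x‖ ^ 2 ∂ν := by
  have key : ∀ z : ℂ, ((‖z‖ ^ 2 : ℝ) : ℂ) = z * (starRingEnd ℂ) z := by
    intro z
    rw [Complex.mul_conj']
    push_cast; rfl
  have h1 : ((∫ x, ‖∑ i ∈ s, φ i x‖ ^ 2 ∂ν : ℝ) : ℂ)
      = ((∑ i ∈ s, ∫ x, ‖φ i x‖ ^ 2 ∂ν : ℝ) : ℂ) := by
    rw [← integral_complex_ofReal]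
    simp only [key, map_sum, Finset.sum_mul_sum, Complex.ofReal_sum]
    rw [integral_finsetSum]
    · refine Finset.sum_congr rfl fun i hi => ?_
      rw [integral_finsetSum]
      · rw [Finset.sum_eq_single i]
        · rw [← integral_complex_ofReal]
          simp only [key]
        · intro j hj hji
          exact ho i hi j hj (Ne.symm hji)
        · intro h; exact absurd hi h
      · intro j hj
        exact ((hn i hi).mul (hn j hj).conj).int ν
    · intro i hi
      exact (QNice.sum s (fun j hj => (hn i hi).mul (hn j hj).conj)).int ν
  exact_mod_cast h1

/-! ### Wave packet condition -/

/-- `F` behaves like a function with Fourier support in the parallelogram over the interval of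
length `q^{-l}` around `a`. -/
def QW (χ : ℚ_[q] → ℂ) (l : ℕ) (a : ℚ_[q]) (F : ℚ_[q] × ℚ_[q] → ℂ) : Prop :=
  ∀ x t : ℚ_[q] × ℚ_[q], ‖t.1 + 2 * a * t.2‖ ≤ (q : ℝ) ^ l → ‖t.2‖ ≤ (q : ℝ) ^ (2 * l) →
    F (x + t) = χ (a * t.1 + a ^ 2 * t.2) * F x

theorem norm_two_le : ‖(2 : ℚ_[q])‖ ≤ 1 := by
  have h' := Padic.norm_int_le_one (p := q) 2
  push_cast at h'
  exact h'

theorem QW.mono (hχ : QChr q χ) {k l : ℕ} (hkl : l ≤ k) {a b : ℚ_[q]}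
    (hab : ‖b - a‖ ≤ ((q : ℝ) ^ l)⁻¹) {F : ℚ_[q] × ℚ_[q] → ℂ} (h : QW χ k b F) : QW χ l a F := by
  intro x t h1 h2
  have hq := q_pos (q := q)
  have hl : (0 : ℝ) < (q : ℝ) ^ l := by positivity
  have e2 : (q : ℝ) ^ (2 * l) = (q : ℝ) ^ l * (q : ℝ) ^ l := by rw [two_mul, pow_add]
  have n1 : ‖(b - a) * t.2‖ ≤ (q : ℝ) ^ l := by
    rw [norm_mul]
    calc ‖b - a‖ * ‖t.2‖ ≤ ((q : ℝ) ^ l)⁻¹ * ((q : ℝ) ^ l * (q : ℝ) ^ l) := by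
          rw [← e2]; gcongr
      _ = (q : ℝ) ^ l := by field_simp
  rw [h x t]
  · congr 1
    apply hχ.congr
    have : b * t.1 + b ^ 2 * t.2 - (a * t.1 + a ^ 2 * t.2)
        = (b - a) * ((t.1 + 2 * a * t.2) + (b - a) * t.2) := by ring
    rw [this, norm_mul]
    calc ‖b - a‖ * ‖(t.1 + 2 * a * t.2) + (b - a) * t.2‖
        ≤ ((q : ℝ) ^ l)⁻¹ * (q : ℝ) ^ l := by
          gcongr
          exact nonarch2 h1 n1
      _ = 1 := by field_simp
  · have : t.1 + 2 * b * t.2 = (t.1 + 2 * a * t.2) + 2 * ((b - a) * t.2) := by ring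
    rw [this]
    refine (nonarch2 h1 ?_).trans (pow_le_pow_right₀ q_one_lt.le hkl)
    rw [norm_mul]
    calc ‖(2 : ℚ_[q])‖ * ‖(b - a) * t.2‖ ≤ 1 * (q : ℝ) ^ l := by
          gcongr
          exact norm_two_le
      _ = _ := one_mul _
  · exact h2.trans (pow_le_pow_right₀ q_one_lt.le (by omega))

theorem QW.horiz {l : ℕ} {a : ℚ_[q]} {F : ℚ_[q] × ℚ_[q] → ℂ} (h : QW χ l a F)
    (x : ℚ_[q] × ℚ_[q]) {t : ℚ_[q]} (ht : ‖t‖ ≤ (q : ℝ) ^ l) :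
    F (x + (t, 0)) = χ (a * t) * F x := by
  rw [h x (t, 0)]
  · simp
  · simpa using ht
  · have := q_pos (q := q)
    simp

theorem QW.slant {l : ℕ} {a : ℚ_[q]} {F : ℚ_[q] × ℚ_[q] → ℂ} (h : QW χ l a F)
    (x : ℚ_[q] × ℚ_[q]) {t : ℚ_[q]} (ht : ‖t‖ ≤ (q : ℝ) ^ (2 * l)) :
    F (x + (-2 * a * t, t)) = χ (-(a ^ 2 * t)) * F x := by
  rw [h x (-2 * a * t, t)]
  · congr 2
    ring
  · have := q_pos (q := q)
    simp
  · exact ht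

theorem QW.zero {l : ℕ} {a : ℚ_[q]} : QW χ l a (fun _ => 0) := by
  intro x t _ _
  simp

theorem QW.sum {ι : Type*} {l : ℕ} {a : ℚ_[q]} (s : Finset ι) {F : ι → ℚ_[q] × ℚ_[q] → ℂ}
    (h : ∀ i ∈ s, QW χ l a (F i)) : QW χ l a (fun x => ∑ i ∈ s, F i x) := by
  intro x t h1 h2
  simp only
  rw [Finset.mul_sum]
  exact Finset.sum_congr rfl fun i hi => h i hi x t h1 h2

/-- Truncation at height `lam`. -/
noncomputable def qtr (lam : ℝ) (F : ℚ_[q] × ℚ_[q] → ℂ) : ℚ_[q] × ℚ_[q] → ℂ :=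
  fun x => if ‖F x‖ ≤ lam then F x else 0

theorem QW.tr (hχ : QChr q χ) {l : ℕ} {a : ℚ_[q]} {F : ℚ_[q] × ℚ_[q] → ℂ} (lam : ℝ)
    (h : QW χ l a F) : QW χ l a (qtr lam F) := by
  intro x t h1 h2
  have e := h x t h1 h2
  have en : ‖F (x + t)‖ = ‖F x‖ := by rw [e, norm_mul, hχ.norm, one_mul]
  unfold qtr
  rw [en]
  split_ifs
  · exact e
  · simp

theorem QNice.tr {F : ℚ_[q] × ℚ_[q] → ℂ} (lam : ℝ) (h : QNice F) : QNice (qtr lam F) :=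
  h.comp (fun z => if ‖z‖ ≤ lam then z else 0) (by simp)

theorem qtr_le {lam : ℝ} (hl : 0 ≤ lam) (F : ℚ_[q] × ℚ_[q] → ℂ) (x : ℚ_[q] × ℚ_[q]) :
    ‖qtr lam F x‖ ≤ lam := by
  unfold qtr
  split_ifs with h
  · exact h
  · simpa using hl

theorem qtr_le_self {lam : ℝ} (F : ℚ_[q] × ℚ_[q] → ℂ) (x : ℚ_[q] × ℚ_[q]) :
    ‖qtr lam F x‖ ≤ ‖F x‖ := by
  unfold qtr
  split_ifs with h
  · exact le_rfl
  · simp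

theorem qtr_sub {lam : ℝ} (hl : 0 < lam) (F : ℚ_[q] × ℚ_[q] → ℂ) (x : ℚ_[q] × ℚ_[q]) :
    ‖F x - qtr lam F x‖ ≤ ‖F x‖ ^ 2 / lam := by
  unfold qtr
  split_ifs with h
  · simp; positivity
  · push Not at h
    rw [sub_zero, le_div_iff₀ hl, pow_two]
    gcongr

end basic

/-! ### The pruned system -/

section pruned
variable {q : ℕ} [Fact q.Prime] {χ : ℚ_[q] → ℂ}

theorem sum_range_level {E : Type*} [AddCommMonoid E] (m n : ℕ) (φ : ℕ → E) :
    ∑ b ∈ Finset.range (m * n), φ b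
      = ∑ a ∈ Finset.range m, ∑ i ∈ Finset.range n, φ (a + i * m) := by
  induction n with
  | zero => simp
  | succ n ih =>
    rw [Nat.mul_succ, Finset.sum_range_add, ih]
    simp only [Finset.sum_range_succ, Finset.sum_add_distrib]
    congr 1
    refine Finset.sum_congr rfl fun i _ => ?_
    congr 1
    ring

theorem sum_range_succ_level {E : Type*} [AddCommMonoid E] (q l : ℕ) (φ : ℕ → E) :
    ∑ b ∈ Finset.range (q ^ (l + 1)), φ b
      = ∑ a ∈ Finset.range (q ^ l), ∑ i ∈ Finset.range q, φ (a + i * q ^ l) := by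
  rw [pow_succ, sum_range_level]

theorem child_lt {q l a i : ℕ} (ha : a < q ^ l) (hi : i < q) : a + i * q ^ l < q ^ (l + 1) := by
  have : (i + 1) * q ^ l ≤ q * q ^ l := Nat.mul_le_mul_right _ hi
  rw [pow_succ]
  nlinarith

theorem child_ne {l a i j : ℕ} (hij : i ≠ j) : a + i * q ^ l ≠ a + j * q ^ l := by
  intro h
  have h1 : i * q ^ l = j * q ^ l := by omega
  exact hij (Nat.eq_of_mul_eq_mul_right (pow_pos (Fact.out : q.Prime).pos l) h1)

theorem child_mod {q k l a i : ℕ} (hkl : l ≤ k) : (a + i * q ^ k) % q ^ l = a % q ^ l := by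
  obtain ⟨d, rfl⟩ := Nat.exists_eq_add_of_le hkl
  rw [pow_add, show a + i * (q ^ l * q ^ d) = a + q ^ l * (i * q ^ d) by ring,
    Nat.add_mul_mod_self_left]

theorem child_near {k l a i : ℕ} (hkl : l ≤ k) :
    ‖((a + i * q ^ k : ℕ) : ℚ_[q]) - (a : ℚ_[q])‖ ≤ ((q : ℝ) ^ l)⁻¹ := by
  rw [norm_sub_le_iff, child_mod hkl]

/-- Pruned functions: `qHn lam F n l a` is the function at level `l`, `n` levels below the top. -/
noncomputable def qHn (lam : ℝ) (F : ℕ → ℚ_[q] × ℚ_[q] → ℂ) :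
    ℕ → ℕ → ℕ → ℚ_[q] × ℚ_[q] → ℂ
  | 0, _, a => F a
  | n + 1, l, a => fun x => ∑ i ∈ Finset.range q, qtr lam (qHn lam F n (l + 1) (a + i * q ^ l)) x

/-- Pruned functions indexed by level. -/
noncomputable def qH (lam : ℝ) (F : ℕ → ℚ_[q] × ℚ_[q] → ℂ) (L l a : ℕ) : ℚ_[q] × ℚ_[q] → ℂ :=
  qHn lam F (L - l) l a

/-- The system of top level functions. -/
structure QSys (χ : ℚ_[q] → ℂ) (L : ℕ) (F : ℕ → ℚ_[q] × ℚ_[q] → ℂ) : Prop where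
  nice : ∀ b, QNice (F b)
  w : ∀ b : ℕ, QW χ L (b : ℚ_[q]) (F b)

variable {lam : ℝ} {F : ℕ → ℚ_[q] × ℚ_[q] → ℂ} {L : ℕ}

theorem qH_top (a : ℕ) : qH lam F L L a = F a := by
  simp [qH, qHn]

theorem qH_succ {l : ℕ} (hl : l < L) (a : ℕ) (x : ℚ_[q] × ℚ_[q]) :
    qH lam F L l a x = ∑ i ∈ Finset.range q, qtr lam (qH lam F L (l + 1) (a + i * q ^ l)) x := by
  have : L - l = (L - (l + 1)) + 1 := by omega
  unfold qH
  rw [this]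
  rfl

theorem qHn_nice (hF : QSys χ L F) (n l a : ℕ) : QNice (qHn lam F n l a) := by
  induction n generalizing l a with
  | zero => exact hF.nice a
  | succ n ih => exact QNice.sum _ fun i _ => (ih _ _).tr lam

theorem qH_nice (hF : QSys χ L F) (l a : ℕ) : QNice (qH lam F L l a) := qHn_nice hF _ _ _

theorem qHn_w (hχ : QChr q χ) (hF : QSys χ L F) (n l a : ℕ) (hn : n + l = L) :
    QW χ l (a : ℚ_[q]) (qHn lam F n l a) := by
  induction n generalizing l a with
  | zero =>
    obtain rfl : l = L := by omega
    exact hF.w a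
  | succ n ih =>
    refine QW.sum _ fun i _ => ?_
    exact ((ih (l + 1) (a + i * q ^ l) (by omega)).tr hχ lam).mono hχ (Nat.le_succ l)
      (child_near le_rfl)

theorem qH_w (hχ : QChr q χ) (hF : QSys χ L F) {l : ℕ} (hl : l ≤ L) (a : ℕ) :
    QW χ l (a : ℚ_[q]) (qH lam F L l a) := qHn_w hχ hF _ _ _ (by omega)

/-- Vanishing of the pruned functions away from the support of the system. -/
theorem qHn_zero {a0 : ℚ_[q]} {ρ : ℝ} (hz : ∀ b : ℕ, ρ < ‖(b : ℚ_[q]) - a0‖ → F b = fun _ => 0)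
    (n l a : ℕ) (hl : ((q : ℝ) ^ l)⁻¹ ≤ ρ) (ha : ρ < ‖(a : ℚ_[q]) - a0‖) :
    qHn lam F n l a = fun _ => 0 := by
  induction n generalizing l a with
  | zero => exact hz a ha
  | succ n ih =>
    funext x
    simp only [qHn]
    refine Finset.sum_eq_zero fun i _ => ?_
    have hc := child_near (q := q) (k := l) (l := l) (a := a) (i := i) le_rfl
    rw [ih (l + 1) (a + i * q ^ l)]
    · simp [qtr]
    · refine le_trans ?_ hl
      have := q_one_lt (q := q)
      gcongr
      · exact this.le
      · omega
    · by_contra hcon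
      push Not at hcon
      have : (a : ℚ_[q]) - a0 = (((a + i * q ^ l : ℕ) : ℚ_[q]) - a0)
          + -(((a + i * q ^ l : ℕ) : ℚ_[q]) - (a : ℚ_[q])) := by ring
      rw [this] at ha
      have h2 := nonarch2 hcon (y := -(((a + i * q ^ l : ℕ) : ℚ_[q]) - (a : ℚ_[q])))
        (by rw [norm_neg]; exact hc.trans hl)
      linarith

theorem qH_zero {a0 : ℚ_[q]} {ρ : ℝ} (hz : ∀ b : ℕ, ρ < ‖(b : ℚ_[q]) - a0‖ → F b = fun _ => 0)
    (l a : ℕ) (hl : ((q : ℝ) ^ l)⁻¹ ≤ ρ) (ha : ρ < ‖(a : ℚ_[q]) - a0‖) :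
    qH lam F L l a = fun _ => 0 := qHn_zero hz _ _ _ hl ha

variable (ν : Measure (ℚ_[q] × ℚ_[q])) [ν.IsAddHaarMeasure]

theorem orth_pair (hχ : QChr q χ) {l : ℕ} {a b : ℚ_[q]} {A B : ℚ_[q] × ℚ_[q] → ℂ}
    (hA : QW χ l a A) (hB : QW χ l b B) (hab : ((q : ℝ) ^ l)⁻¹ < ‖a - b‖) :
    ∫ x, A x * (starRingEnd ℂ) (B x) ∂ν = 0 := by
  obtain ⟨t, ht, hne⟩ := hχ.detect hab
  refine integral_eq_zero_of_translate ν (t, 0) _ hne fun x => ?_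
  rw [hA.horiz x ht, hB.horiz x ht, map_mul, hχ.conj]
  have : χ ((a - b) * t) = χ (a * t) * χ (-(b * t)) := by
    rw [← hχ.mul]; congr 1; ring
  rw [this]
  ring

theorem child_energy (hχ : QChr q χ) (hF : QSys χ L F) {l a : ℕ} (hl : l < L) (ha : a < q ^ l) :
    ∫ x, ‖qH lam F L l a x‖ ^ 2 ∂ν
      = ∑ i ∈ Finset.range q, ∫ x, ‖qtr lam (qH lam F L (l + 1) (a + i * q ^ l)) x‖ ^ 2 ∂ν := by
  simp only [qH_succ hl]
  refine orth_sum ν _ _ (fun i _ => (qH_nice hF _ _).tr lam) fun i hi j hj hij => ?_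
  exact orth_pair ν hχ ((qH_w hχ hF hl _).tr hχ lam) ((qH_w hχ hF hl _).tr hχ lam)
    (norm_sub_gt_of_ne (child_lt ha (Finset.mem_range.1 hj)) (child_lt ha (Finset.mem_range.1 hi))
      (child_ne hij.symm))

theorem energy_le (hχ : QChr q χ) (hF : QSys χ L F) (n l : ℕ) (hl : n + l = L) :
    ∑ a ∈ Finset.range (q ^ l), ∫ x, ‖qH lam F L l a x‖ ^ 2 ∂ν
      ≤ ∑ b ∈ Finset.range (q ^ L), ∫ x, ‖F b x‖ ^ 2 ∂ν := by
  induction n generalizing l with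
  | zero =>
    obtain rfl : l = L := by omega
    simp only [qH_top]
    exact le_rfl
  | succ n ih =>
    refine le_trans ?_ (ih (l + 1) (by omega))
    rw [sum_range_succ_level]
    refine Finset.sum_le_sum fun a ha => ?_
    rw [child_energy ν hχ hF (by omega) (Finset.mem_range.1 ha)]
    refine Finset.sum_le_sum fun i _ => ?_
    refine integral_mono (((qH_nice hF _ _).tr lam).npow two_ne_zero |>.int ν)
      ((qH_nice hF _ _).npow two_ne_zero |>.int ν) fun x => ?_
    simp only
    gcongr
    exact qtr_le_self _ _

/-- The off-diagonal part of `|H_a|²`. -/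
noncomputable def qD (lam : ℝ) (F : ℕ → ℚ_[q] × ℚ_[q] → ℂ) (L l a : ℕ) (x : ℚ_[q] × ℚ_[q]) : ℂ :=
  ∑ p ∈ (Finset.range q).offDiag,
    qtr lam (qH lam F L (l + 1) (a + p.1 * q ^ l)) x
      * (starRingEnd ℂ) (qtr lam (qH lam F L (l + 1) (a + p.2 * q ^ l)) x)

theorem qD_eq {l : ℕ} (hl : l < L) (a : ℕ) (x : ℚ_[q] × ℚ_[q]) :
    ((‖qH lam F L l a x‖ ^ 2 : ℝ) : ℂ)
      = ((∑ i ∈ Finset.range q, ‖qtr lam (qH lam F L (l + 1) (a + i * q ^ l)) x‖ ^ 2 : ℝ) : ℂ)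
        + qD lam F L l a x := by
  have key : ∀ z : ℂ, ((‖z‖ ^ 2 : ℝ) : ℂ) = z * (starRingEnd ℂ) z := by
    intro z
    rw [Complex.mul_conj']
    push_cast; rfl
  rw [qH_succ hl, key, map_sum, Finset.sum_mul_sum, ← Finset.sum_product', Complex.ofReal_sum]
  simp only [key]
  rw [← Finset.diag_union_offDiag, Finset.sum_union (Finset.disjoint_diag_offDiag _),
    Finset.sum_diag]
  rfl

theorem qD_nice (hF : QSys χ L F) (l a : ℕ) : QNice (qD lam F L l a) :=
  QNice.sum _ fun _ _ => ((qH_nice hF _ _).tr lam).mul ((qH_nice hF _ _).tr lam).conj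

theorem orth_four (hq2 : q ≠ 2) (hχ : QChr q χ) {l : ℕ} {a b a1 a2 b1 b2 : ℚ_[q]}
    {A1 A2 B1 B2 : ℚ_[q] × ℚ_[q] → ℂ}
    (hA1 : QW χ (l + 1) a1 A1) (hA2 : QW χ (l + 1) a2 A2)
    (hB1 : QW χ (l + 1) b1 B1) (hB2 : QW χ (l + 1) b2 B2)
    (ha1 : ‖a1 - a‖ ≤ ((q : ℝ) ^ l)⁻¹) (ha2 : ‖a2 - a‖ ≤ ((q : ℝ) ^ l)⁻¹)
    (hb1 : ‖b1 - b‖ ≤ ((q : ℝ) ^ l)⁻¹) (hb2 : ‖b2 - b‖ ≤ ((q : ℝ) ^ l)⁻¹)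
    (hab : ((q : ℝ) ^ l)⁻¹ < ‖b - a‖) (hb : ((q : ℝ) ^ (l + 1))⁻¹ < ‖b2 - b1‖) :
    ∫ x, (A1 x * (starRingEnd ℂ) (A2 x)) * (starRingEnd ℂ) (B1 x * (starRingEnd ℂ) (B2 x)) ∂ν
      = 0 := by
  obtain ⟨t, ht, hne⟩ := hχ.detect hb
  have hq := q_pos (q := q)
  have hba0 : 0 < ‖b - a‖ := lt_trans (by positivity) hab
  have hba : b - a ≠ 0 := norm_pos_iff.1 hba0
  have h2 : (2 : ℚ_[q]) ≠ 0 := by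
    intro h
    have := norm_two (q := q) hq2
    rw [h] at this
    simp at this
  set s : ℚ_[q] := t / (2 * (b - a)) with hs
  have hsn : ‖s‖ ≤ (q : ℝ) ^ (2 * l) := by
    rw [hs, norm_div, norm_mul, norm_two hq2, one_mul, div_le_iff₀ hba0]
    have h3 := norm_ge_of_gt hab
    calc ‖t‖ ≤ (q : ℝ) ^ (l + 1) := ht
      _ = (q : ℝ) ^ (2 * l) * (q * ((q : ℝ) ^ l)⁻¹) := by
        rw [two_mul, pow_succ, pow_add _ l l]; field_simp
      _ ≤ _ := by gcongr
  have hst : 2 * (b - a) * s = t := by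
    rw [hs]; field_simp
  refine integral_eq_zero_of_translate ν (-2 * a * s, s) _ hne fun x => ?_
  have hx : x + (-2 * a * s, s) = x + (-2 * b * s, s) + (t, 0) := by
    rw [← hst]
    ext
    · simp; ring
    · simp
  have eA1 := (hA1.mono hχ (Nat.le_succ l) ha1).slant x hsn
  have eA2 := (hA2.mono hχ (Nat.le_succ l) ha2).slant x hsn
  have eB1 : B1 (x + (-2 * a * s, s)) = χ (b1 * t) * (χ (-(b ^ 2 * s)) * B1 x) := by
    rw [hx, hB1.horiz _ ht, (hB1.mono hχ (Nat.le_succ l) hb1).slant x hsn]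
  have eB2 : B2 (x + (-2 * a * s, s)) = χ (b2 * t) * (χ (-(b ^ 2 * s)) * B2 x) := by
    rw [hx, hB2.horiz _ ht, (hB2.mono hχ (Nat.le_succ l) hb2).slant x hsn]
  rw [eA1, eA2, eB1, eB2]
  simp only [map_mul, hχ.conj, neg_neg, Complex.conj_conj]
  have e : χ ((b2 - b1) * t) = χ (-(a ^ 2 * s)) * χ (a ^ 2 * s) * (χ (-(b1 * t)) * χ (b ^ 2 * s))
      * (χ (b2 * t) * χ (-(b ^ 2 * s))) := by
    simp only [← hχ.mul]
    congr 1; ring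
  rw [e]
  ring

theorem qD_orth (hq2 : q ≠ 2) (hχ : QChr q χ) (hF : QSys χ L F) {l : ℕ} (hl : l < L) :
    ∫ x, ‖∑ a ∈ Finset.range (q ^ l), qD lam F L l a x‖ ^ 2 ∂ν
      = ∑ a ∈ Finset.range (q ^ l), ∫ x, ‖qD lam F L l a x‖ ^ 2 ∂ν := by
  refine orth_sum ν _ _ (fun a _ => qD_nice hF l a) fun a ha b hb hab => ?_
  have ha' := Finset.mem_range.1 ha
  have hb' := Finset.mem_range.1 hb
  have hN : ∀ c (p : ℕ × ℕ), QNice (fun x => qtr lam (qH lam F L (l + 1) (c + p.1 * q ^ l)) x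
      * (starRingEnd ℂ) (qtr lam (qH lam F L (l + 1) (c + p.2 * q ^ l)) x)) := fun c p =>
    ((qH_nice hF _ _).tr lam).mul ((qH_nice hF _ _).tr lam).conj
  have hw : ∀ c, QW χ (l + 1) (c : ℕ) (qtr lam (qH lam F L (l + 1) c)) := fun c =>
    (qH_w hχ hF hl _).tr hχ lam
  unfold qD
  simp only [map_sum, Finset.sum_mul_sum]
  rw [integral_finsetSum]
  · refine Finset.sum_eq_zero fun p hp => ?_
    rw [integral_finsetSum]
    · refine Finset.sum_eq_zero fun p' hp' => ?_
      rw [Finset.mem_offDiag] at hp hp'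
      refine orth_four ν hq2 hχ (hw _) (hw _) (hw _) (hw _) (child_near le_rfl)
        (child_near le_rfl) (child_near (a := b) le_rfl) (child_near le_rfl)
        (norm_sub_gt_of_ne ha' hb' hab)
        (norm_sub_gt_of_ne (child_lt hb' (Finset.mem_range.1 hp'.1))
          (child_lt hb' (Finset.mem_range.1 hp'.2.1)) (child_ne hp'.2.2))
    · intro p' _
      exact ((hN a p).mul (hN b p').conj).int ν
  · intro p _
    exact (QNice.sum _ fun p' _ => (hN a p).mul (hN b p').conj).int ν

theorem qD_bound (hl0 : 0 ≤ lam) {l : ℕ} (hl : l < L) (a : ℕ) (x : ℚ_[q] × ℚ_[q]) :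
    ‖qD lam F L l a x‖ ^ 2 ≤ (q : ℝ) ^ 2 * lam ^ 2 * (‖qH lam F L l a x‖ ^ 2
      + ∑ i ∈ Finset.range q, ‖qtr lam (qH lam F L (l + 1) (a + i * q ^ l)) x‖ ^ 2) := by
  have h1 := qD_eq (lam := lam) (F := F) hl a x
  have h2 : ‖qH lam F L l a x‖ ≤ q * lam := by
    rw [qH_succ hl]
    refine (norm_sum_le _ _).trans ((Finset.sum_le_sum fun i _ => qtr_le hl0 _ x).trans ?_)
    simp
  have h3 : ∑ i ∈ Finset.range q, ‖qtr lam (qH lam F L (l + 1) (a + i * q ^ l)) x‖ ^ 2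
      ≤ q * lam ^ 2 := by
    refine (Finset.sum_le_sum fun i _ => pow_le_pow_left₀ (norm_nonneg _)
      (qtr_le hl0 (qH lam F L (l + 1) (a + i * q ^ l)) x) 2).trans ?_
    simp
  set u := ‖qH lam F L l a x‖ with hu
  set v := ∑ i ∈ Finset.range q, ‖qtr lam (qH lam F L (l + 1) (a + i * q ^ l)) x‖ ^ 2 with hv
  have hv0 : 0 ≤ v := Finset.sum_nonneg fun i _ => by positivity
  have hu0 : 0 ≤ u := norm_nonneg _
  have h4 : qD lam F L l a x = ((u ^ 2 - v : ℝ) : ℂ) := by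
    rw [Complex.ofReal_sub, h1]; ring
  have hq := q_one_lt (q := q)
  rw [h4, Complex.norm_real, Real.norm_eq_abs, sq_abs]
  have h5 : u ^ 2 ≤ (q : ℝ) ^ 2 * lam ^ 2 := by
    rw [← mul_pow]; gcongr
  have h6 : v ≤ (q : ℝ) ^ 2 * lam ^ 2 := by
    refine h3.trans ?_
    gcongr
    nlinarith
  nlinarith [mul_nonneg hv0 (sq_nonneg u), mul_nonneg (sq_nonneg u) (sub_nonneg.2 h5),
    mul_nonneg hv0 (sub_nonneg.2 h6)]

/-- The high part of the square function. -/
noncomputable def qd (lam : ℝ) (F : ℕ → ℚ_[q] × ℚ_[q] → ℂ) (L l : ℕ) (x : ℚ_[q] × ℚ_[q]) : ℝ :=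
  ∑ a ∈ Finset.range (q ^ l), ‖qH lam F L l a x‖ ^ 2
    - ∑ b ∈ Finset.range (q ^ (l + 1)), ‖qtr lam (qH lam F L (l + 1) b) x‖ ^ 2

theorem qd_eq {l : ℕ} (hl : l < L) (x : ℚ_[q] × ℚ_[q]) :
    (qd lam F L l x : ℂ) = ∑ a ∈ Finset.range (q ^ l), qD lam F L l a x := by
  unfold qd
  rw [sum_range_succ_level, Complex.ofReal_sub, Complex.ofReal_sum, Complex.ofReal_sum,
    ← Finset.sum_sub_distrib]
  refine Finset.sum_congr rfl fun a _ => ?_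
  rw [qD_eq hl]
  ring

theorem high_lemma (hq2 : q ≠ 2) (hχ : QChr q χ) (hF : QSys χ L F) (hl0 : 0 ≤ lam) {l : ℕ}
    (hl : l < L) :
    ∫ x, (qd lam F L l x) ^ 2 ∂ν
      ≤ 2 * (q : ℝ) ^ 2 * lam ^ 2 * ∑ b ∈ Finset.range (q ^ L), ∫ x, ‖F b x‖ ^ 2 ∂ν := by
  have h1 : ∀ x, (qd lam F L l x) ^ 2 = ‖∑ a ∈ Finset.range (q ^ l), qD lam F L l a x‖ ^ 2 := by
    intro x
    rw [← qd_eq hl, Complex.norm_real, Real.norm_eq_abs, sq_abs]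
  simp only [h1]
  rw [qD_orth ν hq2 hχ hF hl]
  refine le_trans ?_ (mul_le_mul_of_nonneg_left (energy_le (lam := lam) ν hχ hF (L - l) l (by omega))
    (by positivity))
  rw [Finset.mul_sum]
  refine Finset.sum_le_sum fun a ha => ?_
  have n1 : QNice fun x => ‖qH lam F L l a x‖ ^ 2 := (qH_nice hF _ _).npow two_ne_zero
  have n2 : ∀ i ∈ Finset.range q,
      QNice fun x => ‖qtr lam (qH lam F L (l + 1) (a + i * q ^ l)) x‖ ^ 2 := fun i _ =>
    ((qH_nice hF _ _).tr lam).npow two_ne_zero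
  calc ∫ x, ‖qD lam F L l a x‖ ^ 2 ∂ν
      ≤ ∫ x, (q : ℝ) ^ 2 * lam ^ 2 * (‖qH lam F L l a x‖ ^ 2
      + ∑ i ∈ Finset.range q, ‖qtr lam (qH lam F L (l + 1) (a + i * q ^ l)) x‖ ^ 2) ∂ν :=
        integral_mono (((qD_nice hF l a).npow two_ne_zero).int ν)
          (((n1.add (QNice.sum _ n2)).cmul _).int ν) (fun x => qD_bound hl0 hl a x)
    _ = _ := by
        rw [integral_const_mul, integral_add (n1.int ν) ((QNice.sum _ n2).int ν),
          integral_finsetSum _ (fun i hi => (n2 i hi).int ν),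
          ← child_energy ν hχ hF hl (Finset.mem_range.1 ha)]
        ring

end pruned

/-! ### The bilinear estimate -/

section bilinear
variable {q : ℕ} [Fact q.Prime] {χ : ℚ_[q] → ℂ}

/-- Descendants at level `k` of the interval with index `a` at level `l`. -/
def qdesc (q k l a : ℕ) : Finset ℕ := (Finset.range (q ^ k)).filter (fun b => b % q ^ l = a)

/-- Sum over the descendants. -/
noncomputable def qFF (F : ℕ → ℚ_[q] × ℚ_[q] → ℂ) (L l a : ℕ) (x : ℚ_[q] × ℚ_[q]) : ℂ :=
  ∑ b ∈ qdesc q L l a, F b x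

/-- Sum over the descendants of the pruned functions. -/
noncomputable def qS (lam : ℝ) (F : ℕ → ℚ_[q] × ℚ_[q] → ℂ) (L k l a : ℕ)
    (x : ℚ_[q] × ℚ_[q]) : ℂ :=
  ∑ b ∈ qdesc q k l a, qH lam F L k b x

/-- The square function. -/
noncomputable def qg (lam : ℝ) (F : ℕ → ℚ_[q] × ℚ_[q] → ℂ) (L k : ℕ) (x : ℚ_[q] × ℚ_[q]) : ℝ :=
  ∑ b ∈ Finset.range (q ^ k), ‖qH lam F L k b x‖ ^ 2

variable {lam : ℝ} {F : ℕ → ℚ_[q] × ℚ_[q] → ℂ} {L : ℕ}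

theorem qg_nonneg (k : ℕ) (x : ℚ_[q] × ℚ_[q]) : 0 ≤ qg lam F L k x :=
  Finset.sum_nonneg fun _ _ => by positivity

theorem qg_nice (hF : QSys χ L F) (k : ℕ) : QNice (qg lam F L k) :=
  QNice.sum _ fun _ _ => (qH_nice hF _ _).npow two_ne_zero

theorem qS_nice (hF : QSys χ L F) (k l a : ℕ) : QNice (qS lam F L k l a) :=
  QNice.sum _ fun _ _ => qH_nice hF _ _

theorem qFF_nice (hF : QSys χ L F) (l a : ℕ) : QNice (qFF F L l a) :=
  QNice.sum _ fun _ _ => hF.nice _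

theorem qS_top (l a : ℕ) (x : ℚ_[q] × ℚ_[q]) : qS lam F L L l a x = qFF F L l a x := by
  simp only [qS, qFF, qH_top]

theorem qdesc_self {l a : ℕ} (ha : a < q ^ l) : qdesc q l l a = {a} := by
  ext b
  simp only [qdesc, Finset.mem_filter, Finset.mem_range, Finset.mem_singleton]
  constructor
  · rintro ⟨h1, h2⟩
    rwa [Nat.mod_eq_of_lt h1] at h2
  · rintro rfl
    exact ⟨ha, Nat.mod_eq_of_lt ha⟩

theorem qS_eq_succ {k l : ℕ} (hk : k < L) (hlk : l ≤ k) (a : ℕ) (x : ℚ_[q] × ℚ_[q]) :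
    qS lam F L k l a x = ∑ b ∈ qdesc q (k + 1) l a, qtr lam (qH lam F L (k + 1) b) x := by
  unfold qS qdesc
  rw [Finset.sum_filter, Finset.sum_filter, sum_range_succ_level]
  refine Finset.sum_congr rfl fun b _ => ?_
  simp only [child_mod hlk]
  split_ifs
  · exact qH_succ hk b x
  · simp

theorem qS_step (hl0 : 0 < lam) {k l : ℕ} (hk : k < L) (hlk : l ≤ k) (a : ℕ)
    (x : ℚ_[q] × ℚ_[q]) :
    ‖qS lam F L (k + 1) l a x - qS lam F L k l a x‖ ≤ qg lam F L (k + 1) x / lam := by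
  rw [qS_eq_succ hk hlk, qS, ← Finset.sum_sub_distrib, qg, Finset.sum_div]
  refine (norm_sum_le _ _).trans ?_
  refine (Finset.sum_le_sum fun b _ => qtr_sub hl0 _ x).trans ?_
  exact Finset.sum_le_sum_of_subset_of_nonneg (Finset.filter_subset _ _)
    fun _ _ _ => by positivity

theorem qS_err (hl0 : 0 < lam) (n : ℕ) {k l : ℕ} (hn : n + k = L) (hlk : l ≤ k) (a : ℕ)
    (x : ℚ_[q] × ℚ_[q]) {B : ℝ} (hB : ∀ j, k < j → j ≤ L → qg lam F L j x ≤ B) :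
    ‖qFF F L l a x - qS lam F L k l a x‖ ≤ n * B / lam := by
  induction n generalizing k with
  | zero =>
    obtain rfl : k = L := by omega
    rw [qS_top]; simp
  | succ n ih =>
    have h1 := ih (k := k + 1) (by omega) (by omega) (fun j h1 h2 => hB j (by omega) h2)
    have h2 := qS_step (F := F) hl0 (k := k) (L := L) (by omega) hlk a x
    have h3 : qg lam F L (k + 1) x / lam ≤ B / lam := by
      gcongr
      exact hB _ (by omega) (by omega)
    calc ‖qFF F L l a x - qS lam F L k l a x‖
        = ‖(qFF F L l a x - qS lam F L (k + 1) l a x)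
          + (qS lam F L (k + 1) l a x - qS lam F L k l a x)‖ := by congr 1; ring
      _ ≤ n * B / lam + B / lam := (norm_add_le _ _).trans (by linarith)
      _ = _ := by push_cast; ring

variable (ν : Measure (ℚ_[q] × ℚ_[q])) [ν.IsAddHaarMeasure]

theorem QW.slant' (hχ : QChr q χ) {l k : ℕ} {a b s : ℚ_[q]} {ρ : ℝ} {A : ℚ_[q] × ℚ_[q] → ℂ}
    (hlk : l ≤ k) (hρ : ((q : ℝ) ^ l)⁻¹ ≤ ρ) (hA : QW χ k b A) (hb : ‖b - a‖ ≤ ρ)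
    (hs : ‖s‖ * ρ ≤ (q : ℝ) ^ k) (x : ℚ_[q] × ℚ_[q]) :
    A (x + (-2 * a * s, s)) = χ (((b - a) ^ 2 - a ^ 2) * s) * A x := by
  have hq := q_pos (q := q)
  have hl : (0 : ℝ) < (q : ℝ) ^ l := by positivity
  have hlk' : (q : ℝ) ^ l ≤ (q : ℝ) ^ k := pow_le_pow_right₀ q_one_lt.le hlk
  rw [hA]
  · congr 2; ring
  · have : -2 * a * s + 2 * b * s = 2 * ((b - a) * s) := by ring
    simp only
    rw [this, norm_mul, norm_mul]
    calc ‖(2 : ℚ_[q])‖ * (‖b - a‖ * ‖s‖) ≤ 1 * (ρ * ‖s‖) := by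
          gcongr
          exact norm_two_le
      _ ≤ _ := by linarith
  · simp only
    have h1 : ‖s‖ * ((q : ℝ) ^ l)⁻¹ ≤ (q : ℝ) ^ k := le_trans (by gcongr) hs
    rw [← div_eq_mul_inv, div_le_iff₀ hl] at h1
    calc ‖s‖ ≤ (q : ℝ) ^ k * (q : ℝ) ^ l := h1
      _ ≤ (q : ℝ) ^ k * (q : ℝ) ^ k := by gcongr
      _ = _ := by rw [two_mul, pow_add]

theorem orth_bil (hq2 : q ≠ 2) (hχ : QChr q χ) {l k : ℕ} (hlk : l ≤ k)
    {a a' b1 b2 c1 c2 : ℚ_[q]} {ρ : ℝ} {w B1 B2 C1 C2 : ℚ_[q] × ℚ_[q] → ℂ}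
    (hρ : ‖a - a'‖ = ρ) (hρl : ((q : ℝ) ^ l)⁻¹ < ρ)
    (hB1 : QW χ k b1 B1) (hB2 : QW χ k b2 B2) (hC1 : QW χ k c1 C1) (hC2 : QW χ k c2 C2)
    (hb1 : ‖b1 - a‖ ≤ ((q : ℝ) ^ l)⁻¹) (hb2 : ‖b2 - a‖ ≤ ((q : ℝ) ^ l)⁻¹)
    (hc1 : ‖c1 - a'‖ ≤ ((q : ℝ) ^ l)⁻¹) (hc2 : ‖c2 - a'‖ ≤ ((q : ℝ) ^ l)⁻¹)
    (hw1 : ∀ x t, ‖t‖ ≤ (q : ℝ) ^ k → w (x + (t, 0)) = w x)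
    (hw2 : ∀ x s, ‖s‖ * ρ ≤ (q : ℝ) ^ k → w (x + (-2 * a * s, s)) = w x)
    (hne : ((q : ℝ) ^ k)⁻¹ < ‖b1 - b2‖ ∨ ((q : ℝ) ^ k)⁻¹ < ‖c1 - c2‖) :
    ∫ x, (w x * (B1 x * C1 x)) * (starRingEnd ℂ) (w x * (B2 x * C2 x)) ∂ν = 0 := by
  have hq := q_pos (q := q)
  have hl : (0 : ℝ) < (q : ℝ) ^ l := by positivity
  have hk : (0 : ℝ) < (q : ℝ) ^ k := by positivity
  have hρ0 : 0 < ρ := lt_trans (by positivity) hρl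
  by_cases hcase : ((q : ℝ) ^ k)⁻¹ < ‖(b1 - b2) + (c1 - c2)‖
  · obtain ⟨t, ht, htne⟩ := hχ.detect hcase
    refine integral_eq_zero_of_translate ν (t, 0) _ htne fun x => ?_
    rw [hw1 x t ht, hB1.horiz x ht, hB2.horiz x ht, hC1.horiz x ht, hC2.horiz x ht]
    simp only [map_mul, hχ.conj]
    have e : χ (((b1 - b2) + (c1 - c2)) * t)
        = χ (b1 * t) * χ (c1 * t) * (χ (-(b2 * t)) * χ (-(c2 * t))) := by
      simp only [← hχ.mul]
      congr 1; ring
    rw [e]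
    ring
  · push Not at hcase
    have hδ : ((q : ℝ) ^ k)⁻¹ < ‖b1 - b2‖ := by
      rcases hne with h | h
      · exact h
      · by_contra hcon
        push Not at hcon
        have e : c1 - c2 = ((b1 - b2) + (c1 - c2)) + -(b1 - b2) := by ring
        have := nonarch2 hcase (y := -(b1 - b2)) (by rwa [norm_neg])
        rw [← e] at this
        linarith
    obtain ⟨t, ht, htne⟩ := hχ.detect hδ
    set Y : ℚ_[q] := b1 + b2 - c1 - c2 with hY
    have hYn : ‖Y‖ = ρ := by
      have e : Y = 2 * (a - a') + (((b1 - a) + (b2 - a)) + (-(c1 - a') + -(c2 - a'))) := by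
        rw [hY]; ring
      have n1 : ‖2 * (a - a')‖ = ρ := by rw [norm_mul, norm_two hq2, one_mul, hρ]
      have n2 : ‖((b1 - a) + (b2 - a)) + (-(c1 - a') + -(c2 - a'))‖ ≤ ((q : ℝ) ^ l)⁻¹ :=
        nonarch2 (nonarch2 hb1 hb2) (nonarch2 (by rwa [norm_neg]) (by rwa [norm_neg]))
      rw [e, Padic.add_eq_max_of_ne (by rw [n1]; exact (lt_of_le_of_lt n2 hρl).ne'), n1]
      exact max_eq_left (n2.trans hρl.le)
    have hY0 : Y ≠ 0 := by
      rw [← norm_pos_iff, hYn]; exact hρ0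
    set s := t / Y with hs
    have hsn : ‖s‖ * ρ ≤ (q : ℝ) ^ k := by
      rw [hs, norm_div, hYn, div_mul_cancel₀ _ hρ0.ne']
      exact ht
    have hYs : Y * s = t := by rw [hs]; field_simp
    have m1 : ‖b1 - a‖ ≤ ρ := hb1.trans hρl.le
    have m2 : ‖b2 - a‖ ≤ ρ := hb2.trans hρl.le
    have haa : ‖a' - a‖ ≤ ρ := by rw [norm_sub_rev, hρ]
    have m3 : ‖c1 - a‖ ≤ ρ := by
      have : c1 - a = (c1 - a') + (a' - a) := by ring
      rw [this]
      exact nonarch2 (hc1.trans hρl.le) haa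
    have m4 : ‖c2 - a‖ ≤ ρ := by
      have : c2 - a = (c2 - a') + (a' - a) := by ring
      rw [this]
      exact nonarch2 (hc2.trans hρl.le) haa
    refine integral_eq_zero_of_translate ν (-2 * a * s, s) _ htne fun x => ?_
    rw [hw2 x s hsn, hB1.slant' hχ hlk hρl.le m1 hsn, hB2.slant' hχ hlk hρl.le m2 hsn,
      hC1.slant' hχ hlk hρl.le m3 hsn, hC2.slant' hχ hlk hρl.le m4 hsn]
    simp only [map_mul, hχ.conj]
    have e : χ ((b1 - b2) * t)
        = χ (((b1 - a) ^ 2 - a ^ 2) * s) * χ (((c1 - a) ^ 2 - a ^ 2) * s)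
          * (χ (-(((b2 - a) ^ 2 - a ^ 2) * s)) * χ (-(((c2 - a) ^ 2 - a ^ 2) * s))) := by
      simp only [← hχ.mul]
      apply hχ.congr
      have e2 : (b1 - b2) * t - (((b1 - a) ^ 2 - a ^ 2) * s + ((c1 - a) ^ 2 - a ^ 2) * s
          + (-(((b2 - a) ^ 2 - a ^ 2) * s) + -(((c2 - a) ^ 2 - a ^ 2) * s)))
          = -(((b1 - b2) + (c1 - c2)) * (((c1 - a) + (c2 - a)) * s)) := by
        rw [← hYs, hY]; ring
      rw [e2, norm_neg, norm_mul, norm_mul]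
      calc ‖b1 - b2 + (c1 - c2)‖ * (‖c1 - a + (c2 - a)‖ * ‖s‖)
          ≤ ((q : ℝ) ^ k)⁻¹ * (ρ * ‖s‖) := by
            gcongr
            exact nonarch2 m3 m4
        _ ≤ ((q : ℝ) ^ k)⁻¹ * (q : ℝ) ^ k := by
            gcongr
            linarith
        _ = 1 := by field_simp
    rw [e]
    ring

theorem qdesc_near {k l a b : ℕ} (ha : a < q ^ l) (hb : b ∈ qdesc q k l a) :
    ‖(b : ℚ_[q]) - (a : ℚ_[q])‖ ≤ ((q : ℝ) ^ l)⁻¹ := by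
  rw [norm_sub_le_iff, Nat.mod_eq_of_lt ha]
  exact (Finset.mem_filter.1 hb).2

theorem bil_lemma (hq2 : q ≠ 2) (hχ : QChr q χ) (hF : QSys χ L F) {l k a a' : ℕ} (hlk : l ≤ k)
    (hkL : k ≤ L) (ha : a < q ^ l) (ha' : a' < q ^ l) (haa : a ≠ a')
    {w : ℚ_[q] × ℚ_[q] → ℂ} (hw : IsLocallyConstant w)
    (hw1 : ∀ x t, ‖t‖ ≤ (q : ℝ) ^ k → w (x + (t, 0)) = w x)
    (hw2 : ∀ x s, ‖s‖ * ‖(a : ℚ_[q]) - (a' : ℚ_[q])‖ ≤ (q : ℝ) ^ k →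
      w (x + (-2 * (a : ℚ_[q]) * s, s)) = w x) :
    ∫ x, ‖w x * (qS lam F L k l a x * qS lam F L k l a' x)‖ ^ 2 ∂ν
      ≤ ∫ x, ‖w x‖ ^ 2 * (qg lam F L k x) ^ 2 ∂ν := by
  have hn : ∀ p ∈ qdesc q k l a ×ˢ qdesc q k l a',
      QNice fun x => w x * (qH lam F L k p.1 x * qH lam F L k p.2 x) := fun p _ =>
    QNice.lmul hw ((qH_nice hF _ _).mul (qH_nice hF _ _))
  have h1 : ∀ x, w x * (qS lam F L k l a x * qS lam F L k l a' x)
      = ∑ p ∈ qdesc q k l a ×ˢ qdesc q k l a',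
        w x * (qH lam F L k p.1 x * qH lam F L k p.2 x) := by
    intro x
    rw [qS, qS, Finset.sum_mul_sum, ← Finset.sum_product', Finset.mul_sum]
  simp only [h1]
  rw [orth_sum ν _ _ hn]
  · rw [← integral_finsetSum _ (fun p hp => ((hn p hp).npow two_ne_zero).int ν)]
    refine integral_mono ((QNice.sum _ fun p hp => (hn p hp).npow two_ne_zero).int ν)
      ((QNice.lmul (hw.comp fun z => ‖z‖ ^ 2) ((qg_nice hF k).comp (fun z => z ^ 2)
        (by simp))).int ν) fun x => ?_
    simp only [norm_mul, mul_pow]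
    rw [← Finset.mul_sum, Finset.sum_product' (f := fun i j =>
      ‖qH lam F L k i x‖ ^ 2 * ‖qH lam F L k j x‖ ^ 2), ← Finset.sum_mul_sum]
    have hsub : ∀ c, ∑ b ∈ qdesc q k l c, ‖qH lam F L k b x‖ ^ 2 ≤ qg lam F L k x := fun c =>
      Finset.sum_le_sum_of_subset_of_nonneg (Finset.filter_subset _ _)
        fun _ _ _ => by positivity
    have h0 := qg_nonneg (lam := lam) (F := F) (L := L) k x
    show ‖w x‖ ^ 2 * _ ≤ ‖w x‖ ^ 2 * (qg lam F L k x ^ 2)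
    rw [pow_two (qg lam F L k x)]
    gcongr
    · exact hsub a
    · exact hsub a'
  · intro p hp p' hp' hpp
    rw [Finset.mem_product] at hp hp'
    refine orth_bil ν hq2 hχ hlk rfl (norm_sub_gt_of_ne ha' ha haa.symm) (qH_w hχ hF hkL _)
      (qH_w hχ hF hkL _) (qH_w hχ hF hkL _) (qH_w hχ hF hkL _) (qdesc_near ha hp.1)
      (qdesc_near ha hp'.1) (qdesc_near ha' hp.2) (qdesc_near ha' hp'.2) hw1 hw2 ?_
    have r : ∀ {c b : ℕ}, b ∈ qdesc q k l c → b < q ^ k := fun h =>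
      Finset.mem_range.1 (Finset.mem_filter.1 h).1
    by_cases h : p.1 = p'.1
    · right
      have h' : p.2 ≠ p'.2 := fun h2 => hpp (Prod.ext h h2)
      exact norm_sub_gt_of_ne (r hp'.2) (r hp.2) h'.symm
    · left
      exact norm_sub_gt_of_ne (r hp'.1) (r hp.1) (Ne.symm h)

/-- Thresholds. -/
noncomputable def qth (L : ℕ) (G : ℝ) (j : ℕ) : ℝ := (1 + ((L : ℝ) - j) / L) * G

open scoped Classical in
/-- Indicator of the set where the high part dominates first at level `k`. -/
noncomputable def qw (lam : ℝ) (F : ℕ → ℚ_[q] × ℚ_[q] → ℂ) (L : ℕ) (G : ℝ) (k : ℕ)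
    (x : ℚ_[q] × ℚ_[q]) : ℂ :=
  if qth L G k < qg lam F L k x ∧ ∀ j ∈ Finset.Ioc k L, qg lam F L j x ≤ qth L G j then 1 else 0

theorem qw_congr {G : ℝ} {k : ℕ} {x y : ℚ_[q] × ℚ_[q]}
    (h : ∀ j, k ≤ j → j ≤ L → qg lam F L j x = qg lam F L j y) (hk : k ≤ L) :
    qw lam F L G k x = qw lam F L G k y := by
  unfold qw
  have h1 : (∀ j ∈ Finset.Ioc k L, qg lam F L j x ≤ qth L G j)
      ↔ (∀ j ∈ Finset.Ioc k L, qg lam F L j y ≤ qth L G j) := by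
    refine forall₂_congr fun j hj => ?_
    rw [Finset.mem_Ioc] at hj
    rw [h j hj.1.le hj.2]
  simp only [h1, h k le_rfl hk]

theorem qw_lc (hF : QSys χ L F) {G : ℝ} {k : ℕ} (hk : k ≤ L) :
    IsLocallyConstant (qw lam F L G k) := by
  rw [IsLocallyConstant.iff_eventually_eq]
  intro x
  have : ∀ᶠ y in nhds x, ∀ j ∈ Finset.range (L + 1), qg lam F L j y = qg lam F L j x :=
    (Filter.eventually_all_finset _).2 fun j _ => (qg_nice hF j).1.eventually_eq x
  filter_upwards [this] with y hy
  exact qw_congr (fun j _ hj => hy j (Finset.mem_range.2 (by omega))) hk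

theorem qg_horiz (hχ : QChr q χ) (hF : QSys χ L F) {k j : ℕ} (hkj : k ≤ j) (hj : j ≤ L)
    (x : ℚ_[q] × ℚ_[q]) {t : ℚ_[q]} (ht : ‖t‖ ≤ (q : ℝ) ^ k) :
    qg lam F L j (x + (t, 0)) = qg lam F L j x := by
  refine Finset.sum_congr rfl fun b _ => ?_
  rw [(qH_w hχ hF hj b).horiz x (ht.trans (pow_le_pow_right₀ q_one_lt.le hkj)), norm_mul, hχ.norm,
    one_mul]

theorem qg_slant (hχ : QChr q χ) (hF : QSys χ L F) {l k j : ℕ} (hlk : l ≤ k) (hkj : k ≤ j)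
    (hj : j ≤ L) {a0 : ℚ_[q]} {ρ : ℝ} (hρ : ((q : ℝ) ^ l)⁻¹ ≤ ρ)
    (hz : ∀ b : ℕ, ρ < ‖(b : ℚ_[q]) - a0‖ → F b = fun _ => 0)
    (x : ℚ_[q] × ℚ_[q]) {s : ℚ_[q]} (hs : ‖s‖ * ρ ≤ (q : ℝ) ^ k) :
    qg lam F L j (x + (-2 * a0 * s, s)) = qg lam F L j x := by
  refine Finset.sum_congr rfl fun b _ => ?_
  have hq := q_one_lt (q := q)
  by_cases hb : ‖(b : ℚ_[q]) - a0‖ ≤ ρ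
  · rw [(qH_w hχ hF hj b).slant' hχ (hlk.trans hkj) hρ hb
      (hs.trans (pow_le_pow_right₀ hq.le hkj)), norm_mul, hχ.norm, one_mul]
  · push Not at hb
    rw [qH_zero hz j b _ hb]
    refine le_trans ?_ hρ
    gcongr
    · exact hq.le
    · omega

theorem qg_le_succ (k : ℕ) (x : ℚ_[q] × ℚ_[q]) :
    qg lam F L k x ≤ qg lam F L (k + 1) x + qd lam F L k x := by
  unfold qd
  have : ∑ b ∈ Finset.range (q ^ (k + 1)), ‖qtr lam (qH lam F L (k + 1) b) x‖ ^ 2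
      ≤ qg lam F L (k + 1) x := by
    refine Finset.sum_le_sum fun b _ => ?_
    gcongr
    exact qtr_le_self _ _
  unfold qg at *
  linarith

theorem qth_le {G : ℝ} (hG : 0 ≤ G) (j : ℕ) : qth L G j ≤ 2 * G := by
  unfold qth
  gcongr
  have : ((L : ℝ) - j) / L ≤ 1 := by
    apply div_le_one_of_le₀ _ (by positivity)
    have : (0 : ℝ) ≤ j := by positivity
    linarith
  linarith

theorem qw_bound {G : ℝ} (hG : 0 < G) {k : ℕ} (hk : k < L) (x : ℚ_[q] × ℚ_[q]) :
    ‖qw lam F L G k x‖ ^ 2 * (qg lam F L k x) ^ 2 ≤ (3 * L) ^ 2 * (qd lam F L k x) ^ 2 := by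
  unfold qw
  split_ifs with h
  · obtain ⟨h1, h2⟩ := h
    have h3 := h2 (k + 1) (Finset.mem_Ioc.2 ⟨by omega, by omega⟩)
    have h4 := qg_le_succ (lam := lam) (F := F) (L := L) k x
    have h5 := qth_le (L := L) hG.le (k + 1)
    have hL : (1 : ℝ) ≤ L := by exact_mod_cast (by omega : 1 ≤ L)
    have h6 : qth L G k = qth L G (k + 1) + G / L := by
      unfold qth; push_cast; field_simp; ring
    have h7 : G / L < qd lam F L k x := by linarith
    have h8 : G ≤ L * qd lam F L k x := by
      rw [div_lt_iff₀ (by linarith)] at h7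
      linarith
    have hd : 0 < qd lam F L k x := lt_trans (by positivity) h7
    have h9 : qg lam F L k x ≤ 3 * L * qd lam F L k x := by nlinarith
    rw [norm_one, one_pow, one_mul, ← mul_pow]
    have := qg_nonneg (lam := lam) (F := F) (L := L) k x
    gcongr
  · rw [norm_zero]
    have : (0 : ℝ) ≤ (3 * L) ^ 2 * (qd lam F L k x) ^ 2 := by positivity
    simpa using this

theorem qd_nice (hF : QSys χ L F) {k : ℕ} : QNice (fun x => (qd lam F L k x) ^ 2) := by
  have h : QNice (qd lam F L k) := by
    refine QNice.comp2 (φ := fun u v : ℝ => u - v) (qg_nice (lam := lam) hF k)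
      (QNice.sum (Finset.range (q ^ (k + 1)))
        (F := fun b x => ‖qtr lam (qH lam F L (k + 1) b) x‖ ^ 2) ?_) (by simp)
    intro b _
    exact ((qH_nice hF _ _).tr lam).npow two_ne_zero
  exact h.comp (fun z => z ^ 2) (by simp)

end bilinear

/-! ### The bilinear estimate: level sets -/

section bilinear2
variable {q : ℕ} [Fact q.Prime] {χ : ℚ_[q] → ℂ}
variable {F : ℕ → ℚ_[q] × ℚ_[q] → ℂ} {L : ℕ}

/-- The bilinear quantity. -/
noncomputable def qPsi (z w : ℂ) : ℝ := ‖z‖ ^ 2 * ‖w‖ ^ 2 * (min ‖z‖ ‖w‖) ^ 2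

theorem qPsi_nonneg (z w : ℂ) : 0 ≤ qPsi z w := by unfold qPsi; positivity

open scoped Classical in
/-- The bilinear quantity localized to `min ∈ [γ, qγ)`. -/
noncomputable def qPsiG (c γ : ℝ) (z w : ℂ) : ℝ :=
  if γ ≤ min ‖z‖ ‖w‖ ∧ min ‖z‖ ‖w‖ < c * γ then qPsi z w else 0

theorem qPsiG_nonneg (c γ : ℝ) (z w : ℂ) : 0 ≤ qPsiG c γ z w := by
  unfold qPsiG; split_ifs
  · exact qPsi_nonneg _ _
  · exact le_rfl

theorem qPsi_nice {A B : ℚ_[q] × ℚ_[q] → ℂ} (hA : QNice A) (hB : QNice B) :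
    QNice (fun x => qPsi (A x) (B x)) :=
  QNice.comp2 (φ := qPsi) hA hB (by simp [qPsi])

theorem qPsiG_nice (c γ : ℝ) {A B : ℚ_[q] × ℚ_[q] → ℂ} (hA : QNice A) (hB : QNice B) :
    QNice (fun x => qPsiG c γ (A x) (B x)) :=
  QNice.comp2 (φ := qPsiG c γ) hA hB (by simp [qPsi, qPsiG])

theorem level_ptw {c γ G : ℝ} (hc : 0 ≤ c) (hγ : 0 < γ) (hG : 0 < G) (hL : 1 ≤ L) {l a a' : ℕ} (hl : l ≤ L)
    (ha : a < q ^ l) (ha' : a' < q ^ l) (x : ℚ_[q] × ℚ_[q])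
    (hg : qg (4 * L * G / γ) F L L x ≤ G) :
    qPsiG c γ (qFF F L l a x) (qFF F L l a' x) ≤
      256 * G ^ 2 * qg (4 * L * G / γ) F L l x + ∑ k ∈ Finset.Ico l L, 16 * c ^ 2 * γ ^ 2 *
        ‖qw (4 * L * G / γ) F L G k x * (qS (4 * L * G / γ) F L k l a x
          * qS (4 * L * G / γ) F L k l a' x)‖ ^ 2 := by
  have hL' : (1 : ℝ) ≤ L := by exact_mod_cast hL
  set lam := 4 * L * G / γ with hlam
  have hl0 : 0 < lam := by positivity
  have hg0 := qg_nonneg (lam := lam) (F := F) (L := L) l x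
  have hsum0 : ∀ k ∈ Finset.Ico l L, 0 ≤ 16 * c ^ 2 * γ ^ 2 *
        ‖qw lam F L G k x * (qS lam F L k l a x * qS lam F L k l a' x)‖ ^ 2 :=
    fun k _ => by positivity
  unfold qPsiG
  split_ifs with hmin
  swap
  · have := Finset.sum_nonneg hsum0
    positivity
  obtain ⟨hm1, hm2⟩ := hmin
  have hz := hm1.trans (min_le_left _ _)
  have hw := hm1.trans (min_le_right _ _)
  -- comparison once all levels above are good
  have key : ∀ k, l ≤ k → k ≤ L → (∀ j, k < j → j ≤ L → qg lam F L j x ≤ qth L G j) →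
      ∀ d, γ ≤ ‖qFF F L l d x‖ → ‖qFF F L l d x‖ ≤ 2 * ‖qS lam F L k l d x‖ := by
    intro k hk1 hk2 hgood d hd
    have h1 := qS_err (F := F) (x := x) hl0 (L - k) (k := k) (L := L) (by omega) hk1 d
      (B := 2 * G) (fun j h1 h2 => (hgood j h1 h2).trans (qth_le hG.le j))
    have h2 : ((L - k : ℕ) : ℝ) ≤ L := by exact_mod_cast Nat.sub_le _ _
    have h3 : ((L - k : ℕ) : ℝ) * (2 * G) / lam ≤ γ / 2 := by
      rw [div_le_iff₀ hl0]
      have : γ / 2 * lam = L * (2 * G) := by rw [hlam]; field_simp; ring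
      rw [this]
      gcongr
    have h4 := norm_sub_norm_le (qFF F L l d x) (qS lam F L k l d x)
    linarith
  by_cases hall : ∀ j, l ≤ j → j ≤ L → qg lam F L j x ≤ qth L G j
  · have hgood : ∀ j, l < j → j ≤ L → qg lam F L j x ≤ qth L G j := fun j h1 h2 => hall j h1.le h2
    have k1 := key l le_rfl hl hgood a hz
    have k2 := key l le_rfl hl hgood a' hw
    have hgl := (hall l le_rfl hl).trans (qth_le hG.le l)
    have hS : ∀ d, d < q ^ l → ‖qS lam F L l l d x‖ ^ 2 ≤ qg lam F L l x := by
      intro d hd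
      rw [qS, qdesc_self hd, Finset.sum_singleton]
      exact Finset.single_le_sum (f := fun b => ‖qH lam F L l b x‖ ^ 2)
        (fun _ _ => by positivity) (Finset.mem_range.2 hd)
    have s1 : ‖qFF F L l a x‖ ^ 2 ≤ 4 * qg lam F L l x := by
      have := hS a ha
      have : ‖qFF F L l a x‖ ^ 2 ≤ (2 * ‖qS lam F L l l a x‖) ^ 2 := by gcongr
      nlinarith
    have s2 : ‖qFF F L l a' x‖ ^ 2 ≤ 4 * qg lam F L l x := by
      have := hS a' ha'
      have : ‖qFF F L l a' x‖ ^ 2 ≤ (2 * ‖qS lam F L l l a' x‖) ^ 2 := by gcongr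
      nlinarith
    have s3 : (min ‖qFF F L l a x‖ ‖qFF F L l a' x‖) ^ 2 ≤ 4 * qg lam F L l x := by
      refine le_trans ?_ s1
      gcongr
      exact min_le_left _ _
    have : qPsi (qFF F L l a x) (qFF F L l a' x)
        ≤ (4 * qg lam F L l x) * (4 * qg lam F L l x) * (4 * qg lam F L l x) := by
      unfold qPsi
      gcongr
    have h2 : (4 * qg lam F L l x) * (4 * qg lam F L l x) * (4 * qg lam F L l x)
        ≤ (4 * (2 * G)) * (4 * (2 * G)) * (4 * qg lam F L l x) := by gcongr
    have := Finset.sum_nonneg hsum0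
    nlinarith
  · push Not at hall
    classical
    obtain ⟨j0, hj1, hj2, hj3⟩ := hall
    set S := (Finset.Icc l L).filter (fun j => qth L G j < qg lam F L j x) with hS
    have hSne : S.Nonempty := ⟨j0, by simp [hS, hj1, hj2, hj3]⟩
    set k := S.max' hSne with hkdef
    have hk := S.max'_mem hSne
    rw [← hkdef, hS, Finset.mem_filter, Finset.mem_Icc] at hk
    obtain ⟨⟨hk1, hk2⟩, hk3⟩ := hk
    have hgood : ∀ j, k < j → j ≤ L → qg lam F L j x ≤ qth L G j := by
      intro j h1 h2
      by_contra hcon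
      push Not at hcon
      have : j ≤ k := S.le_max' j (by simp [hS, h2, hcon]; omega)
      omega
    have hkL : k < L := by
      rcases hk2.lt_or_eq with h | h
      · exact h
      · exfalso
        rw [h] at hk3
        have : qth L G L = G := by unfold qth; simp
        linarith
    have hwk : qw lam F L G k x = 1 := by
      unfold qw
      rw [if_pos]
      exact ⟨hk3, fun j hj => hgood j (Finset.mem_Ioc.1 hj).1 (Finset.mem_Ioc.1 hj).2⟩
    have k1 := key k hk1 hk2 hgood a hz
    have k2 := key k hk1 hk2 hgood a' hw
    have hs := Finset.single_le_sum hsum0 (Finset.mem_Ico.2 ⟨hk1, hkL⟩)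
    rw [hwk, one_mul] at hs
    have : qPsi (qFF F L l a x) (qFF F L l a' x) ≤ (2 * ‖qS lam F L k l a x‖) ^ 2
        * (2 * ‖qS lam F L k l a' x‖) ^ 2 * (c * γ) ^ 2 := by
      unfold qPsi
      gcongr
    rw [norm_mul] at hs
    have e : (2 * ‖qS lam F L k l a x‖) ^ 2
        * (2 * ‖qS lam F L k l a' x‖) ^ 2 * (c * γ) ^ 2 = 16 * c ^ 2 * γ ^ 2 *
        (‖qS lam F L k l a x‖ * ‖qS lam F L k l a' x‖) ^ 2 := by ring
    have : 0 ≤ 256 * G ^ 2 * qg lam F L l x := by positivity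
    linarith

variable (ν : Measure (ℚ_[q] × ℚ_[q])) [ν.IsAddHaarMeasure]

theorem level_lemma (hq2 : q ≠ 2) (hχ : QChr q χ) (hF : QSys χ L F) {γ G : ℝ} (hγ : 0 < γ)
    (hG : 0 < G) (hL : 1 ≤ L) {l a a' : ℕ} (hl : l ≤ L)
    (ha : a < q ^ l) (ha' : a' < q ^ l) (haa : a ≠ a')
    (hg : ∀ x, ∑ b ∈ Finset.range (q ^ L), ‖F b x‖ ^ 2 ≤ G)
    (hz : ∀ b : ℕ, ‖(a : ℚ_[q]) - (a' : ℚ_[q])‖ < ‖(b : ℚ_[q]) - (a : ℚ_[q])‖ → F b = fun _ => 0) :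
    ∫ x, qPsiG q γ (qFF F L l a x) (qFF F L l a' x) ∂ν ≤
      4864 * (q : ℝ) ^ 4 * (L : ℝ) ^ 5 * G ^ 2 *
        ∑ b ∈ Finset.range (q ^ L), ∫ x, ‖F b x‖ ^ 2 ∂ν := by
  have hL' : (1 : ℝ) ≤ L := by exact_mod_cast hL
  have hq1 := q_one_lt (q := q)
  set lam := 4 * L * G / γ with hlam
  have hl0 : 0 < lam := by positivity
  set E := ∑ b ∈ Finset.range (q ^ L), ∫ x, ‖F b x‖ ^ 2 ∂ν with hE
  have hE0 : 0 ≤ E := Finset.sum_nonneg fun b _ => integral_nonneg fun x => by positivity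
  have hgL : ∀ x, qg lam F L L x ≤ G := by
    intro x
    simp only [qg, qH_top]
    exact hg x
  have n1 : Integrable (fun x => 256 * G ^ 2 * qg lam F L l x) ν := ((qg_nice hF l).int ν).const_mul _
  have n2 : ∀ k ∈ Finset.Ico l L, Integrable (fun x => 16 * (q : ℝ) ^ 2 * γ ^ 2 *
        ‖qw lam F L G k x * (qS lam F L k l a x * qS lam F L k l a' x)‖ ^ 2) ν := by
    intro k hk
    rw [Finset.mem_Ico] at hk
    exact ((((QNice.lmul (qw_lc hF hk.2.le) ((qS_nice hF k l a).mul (qS_nice hF k l a'))).npow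
      two_ne_zero)).int ν).const_mul _
  have h1 : ∫ x, qPsiG q γ (qFF F L l a x) (qFF F L l a' x) ∂ν ≤ ∫ x, (256 * G ^ 2 * qg lam F L l x
      + ∑ k ∈ Finset.Ico l L, 16 * (q : ℝ) ^ 2 * γ ^ 2 *
        ‖qw lam F L G k x * (qS lam F L k l a x * qS lam F L k l a' x)‖ ^ 2) ∂ν :=
    integral_mono ((qPsiG_nice q γ (qFF_nice hF l a) (qFF_nice hF l a')).int ν)
      (n1.add (integrable_finsetSum _ n2))
      fun x => level_ptw (by positivity) hγ hG hL hl ha ha' x (hgL x)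
  refine h1.trans ?_
  rw [integral_add n1 (integrable_finsetSum _ n2), integral_finsetSum _ n2, integral_const_mul]
  have h2 : ∫ x, qg lam F L l x ∂ν ≤ E := by
    unfold qg
    rw [integral_finsetSum _ (fun b _ => ((qH_nice hF l b).npow two_ne_zero).int ν)]
    exact energy_le ν hχ hF (L - l) l (by omega)
  have h3 : ∀ k ∈ Finset.Ico l L, ∫ x, 16 * (q : ℝ) ^ 2 * γ ^ 2 *
        ‖qw lam F L G k x * (qS lam F L k l a x * qS lam F L k l a' x)‖ ^ 2 ∂ν
        ≤ 4608 * (q : ℝ) ^ 4 * (L : ℝ) ^ 4 * G ^ 2 * E := by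
    intro k hk
    rw [Finset.mem_Ico] at hk
    rw [integral_const_mul]
    have b1 := bil_lemma (lam := lam) ν hq2 hχ hF hk.1 hk.2.le ha ha' haa
      (w := qw lam F L G k) (qw_lc hF hk.2.le)
      (fun x t ht => qw_congr (fun j h1 h2 => qg_horiz hχ hF h1 h2 x ht) hk.2.le)
      (fun x s hs => qw_congr (fun j h1 h2 => qg_slant hχ hF hk.1 h1 h2
        (norm_sub_gt_of_ne ha' ha haa.symm).le hz x hs) hk.2.le)
    have b2 : ∫ x, ‖qw lam F L G k x‖ ^ 2 * (qg lam F L k x) ^ 2 ∂ν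
        ≤ ∫ x, (3 * (L : ℝ)) ^ 2 * (qd lam F L k x) ^ 2 ∂ν := by
      refine integral_mono ((QNice.lmul ((qw_lc hF hk.2.le).comp fun z => ‖z‖ ^ 2)
        ((qg_nice hF k).comp (fun z => z ^ 2) (by simp))).int ν)
        (((qd_nice hF).int ν).const_mul _) fun x => qw_bound hG hk.2 x
    rw [integral_const_mul] at b2
    have b3 := high_lemma (lam := lam) ν hq2 hχ hF hl0.le hk.2
    have b4 : γ * lam = 4 * L * G := by rw [hlam]; field_simp
    calc _ ≤ 16 * (q : ℝ) ^ 2 * γ ^ 2 * ((3 * (L : ℝ)) ^ 2 * (2 * (q : ℝ) ^ 2 * lam ^ 2 * E)) := by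
          gcongr
          exact b1.trans (b2.trans (by gcongr))
      _ = 288 * (q : ℝ) ^ 4 * L ^ 2 * (γ * lam) ^ 2 * E := by ring
      _ = _ := by rw [b4]; ring
  have h4 := Finset.sum_le_sum h3
  rw [Finset.sum_const, Nat.card_Ico, nsmul_eq_mul] at h4
  have h5 : ((L - l : ℕ) : ℝ) ≤ L := by exact_mod_cast Nat.sub_le _ _
  calc _ ≤ 256 * G ^ 2 * E + L * (4608 * (q : ℝ) ^ 4 * (L : ℝ) ^ 4 * G ^ 2 * E) := by
        gcongr
        exact h4.trans (by gcongr)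
    _ ≤ 256 * G ^ 2 * E * ((q : ℝ) ^ 4 * (L : ℝ) ^ 5)
        + L * (4608 * (q : ℝ) ^ 4 * (L : ℝ) ^ 4 * G ^ 2 * E) := by
        refine add_le_add (le_mul_of_one_le_right (by positivity) ?_) le_rfl
        exact one_le_mul_of_one_le_of_one_le (one_le_pow₀ hq1.le) (one_le_pow₀ hL')
    _ = _ := by ring

end bilinear2

/-! ### The bilinear estimate: summing the levels -/

section bilinear3
variable {q : ℕ} [Fact q.Prime] {χ : ℚ_[q] → ℂ}
variable {F : ℕ → ℚ_[q] × ℚ_[q] → ℂ} {L : ℕ}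

theorem qFF_sq_le (l d : ℕ) (x : ℚ_[q] × ℚ_[q]) :
    ‖qFF F L l d x‖ ^ 2 ≤ (q : ℝ) ^ L * ∑ b ∈ Finset.range (q ^ L), ‖F b x‖ ^ 2 := by
  unfold qFF
  have h1 : ‖∑ b ∈ qdesc q L l d, F b x‖ ≤ ∑ b ∈ Finset.range (q ^ L), ‖F b x‖ :=
    (norm_sum_le _ _).trans (Finset.sum_le_sum_of_subset_of_nonneg (Finset.filter_subset _ _)
      fun _ _ _ => by positivity)
  have h2 := sq_sum_le_card_mul_sum_sq (s := Finset.range (q ^ L)) (f := fun b => ‖F b x‖)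
  rw [Finset.card_range] at h2
  push_cast at h2
  refine le_trans ?_ h2
  gcongr

theorem qPsi_le_sum {G : ℝ} (hG : 0 < G) (hL : 1 ≤ L) {l a a' : ℕ} (x : ℚ_[q] × ℚ_[q])
    (hg : ∑ b ∈ Finset.range (q ^ L), ‖F b x‖ ^ 2 ≤ G) :
    qPsi (qFF F L l a x) (qFF F L l a' x) ≤
      ∑ i ∈ Finset.range (3 * L + 1),
        qPsiG q (Real.sqrt G / (q : ℝ) ^ (2 * L) * (q : ℝ) ^ i) (qFF F L l a x) (qFF F L l a' x)
      + G ^ 2 * ∑ b ∈ Finset.range (q ^ L), ‖F b x‖ ^ 2 := by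
  have hq1 := q_one_lt (q := q)
  have hq0 := q_pos (q := q)
  set Q := (q : ℝ) ^ L with hQ
  have hQ1 : 1 ≤ Q := one_le_pow₀ hq1.le
  set T := ∑ b ∈ Finset.range (q ^ L), ‖F b x‖ ^ 2 with hT
  have hT0 : 0 ≤ T := Finset.sum_nonneg fun b _ => by positivity
  have hz : ‖qFF F L l a x‖ ^ 2 ≤ Q * T := qFF_sq_le l a x
  have hw : ‖qFF F L l a' x‖ ^ 2 ≤ Q * T := qFF_sq_le l a' x
  set z := qFF F L l a x
  set w := qFF F L l a' x
  have hs0 : 0 < Real.sqrt G := Real.sqrt_pos.2 hG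
  have hs2 : Real.sqrt G ^ 2 = G := Real.sq_sqrt hG.le
  have hQ2 : (q : ℝ) ^ (2 * L) = Q ^ 2 := by rw [hQ, ← pow_mul, mul_comm]
  set γ := Real.sqrt G / (q : ℝ) ^ (2 * L) with hγ
  have hγ0 : 0 < γ := by positivity
  have hsum : ∀ i ∈ Finset.range (3 * L + 1), 0 ≤ qPsiG q (γ * (q : ℝ) ^ i) z w :=
    fun i _ => qPsiG_nonneg _ _ _ _
  set m := min ‖z‖ ‖w‖ with hm
  have hm0 : 0 ≤ m := le_min (norm_nonneg _) (norm_nonneg _)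
  by_cases hcase : m < γ
  · have h1 : qPsi z w ≤ m ^ 2 * m ^ 2 * (Q * T) := by
      have e : ‖z‖ ^ 2 * ‖w‖ ^ 2 = m ^ 2 * (max ‖z‖ ‖w‖) ^ 2 := by
        rw [hm, ← mul_pow, ← mul_pow, min_mul_max]
      have e2 : (max ‖z‖ ‖w‖) ^ 2 ≤ Q * T := by
        rcases max_choice ‖z‖ ‖w‖ with h | h <;> rw [h] <;> assumption
      unfold qPsi
      rw [e, ← hm]
      have : 0 ≤ m ^ 2 * m ^ 2 := by positivity
      nlinarith
    have h2 : m ^ 2 ≤ γ ^ 2 := by gcongr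
    have h3 : γ ^ 2 * γ ^ 2 * (Q * T) ≤ G ^ 2 * T := by
      have e : γ ^ 2 * γ ^ 2 * (Q * T) = (G ^ 2 * T) * (Q / Q ^ 8) := by
        rw [hγ, hQ2, div_pow, hs2]
        field_simp
      rw [e]
      apply mul_le_of_le_one_right (by positivity)
      rw [div_le_one (by positivity)]
      exact le_self_pow₀ hQ1 (by norm_num)
    have h4 : m ^ 2 * m ^ 2 * (Q * T) ≤ γ ^ 2 * γ ^ 2 * (Q * T) := by gcongr
    have := Finset.sum_nonneg hsum
    linarith
  · push Not at hcase
    obtain ⟨n, hn1, hn2⟩ := exists_nat_pow_near (x := m / γ) (y := (q : ℝ))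
      ((one_le_div hγ0).2 hcase) hq1
    rw [le_div_iff₀ hγ0] at hn1
    rw [div_lt_iff₀ hγ0] at hn2
    have hn : n ≤ 3 * L := by
      by_contra hcon
      push Not at hcon
      have h1 : (q : ℝ) ^ (3 * L) < (q : ℝ) ^ n := pow_lt_pow_right₀ hq1 hcon
      have h2 : (q : ℝ) ^ (3 * L) * γ < m := lt_of_lt_of_le (by gcongr) hn1
      have h3 : (q : ℝ) ^ (3 * L) * γ = Q * Real.sqrt G := by
        rw [hγ, hQ2, (by rw [hQ, ← pow_mul, mul_comm] : (q : ℝ) ^ (3 * L) = Q ^ 3)]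
        field_simp
      rw [h3] at h2
      have h4 : (Q * Real.sqrt G) ^ 2 < m ^ 2 := by gcongr
      rw [mul_pow, hs2] at h4
      have h5 : m ^ 2 ≤ ‖z‖ ^ 2 := by
        gcongr
        exact min_le_left _ _
      have h6 : Q * T ≤ Q ^ 2 * G := by
        have : Q * T ≤ Q * G := by gcongr
        nlinarith
      linarith
    have hs := Finset.single_le_sum hsum (Finset.mem_range.2 (by omega : n < 3 * L + 1))
    have e : qPsiG q (γ * (q : ℝ) ^ n) z w = qPsi z w := by
      unfold qPsiG
      rw [if_pos]
      refine ⟨by linarith, ?_⟩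
      rw [← hm]
      rw [pow_succ] at hn2
      linarith
    rw [e] at hs
    have : 0 ≤ G ^ 2 * T := by positivity
    linarith

variable (ν : Measure (ℚ_[q] × ℚ_[q])) [ν.IsAddHaarMeasure]

theorem bil_full (hq2 : q ≠ 2) (hχ : QChr q χ) (hF : QSys χ L F) {G : ℝ}
    (hG : 0 ≤ G) (hL : 1 ≤ L) {l a a' : ℕ} (hl : l ≤ L)
    (ha : a < q ^ l) (ha' : a' < q ^ l) (haa : a ≠ a')
    (hg : ∀ x, ∑ b ∈ Finset.range (q ^ L), ‖F b x‖ ^ 2 ≤ G)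
    (hz : ∀ b : ℕ, ‖(a : ℚ_[q]) - (a' : ℚ_[q])‖ < ‖(b : ℚ_[q]) - (a : ℚ_[q])‖ → F b = fun _ => 0) :
    ∫ x, qPsi (qFF F L l a x) (qFF F L l a' x) ∂ν ≤
      20000 * (q : ℝ) ^ 4 * (L : ℝ) ^ 6 * G ^ 2 *
        ∑ b ∈ Finset.range (q ^ L), ∫ x, ‖F b x‖ ^ 2 ∂ν := by
  have hL' : (1 : ℝ) ≤ L := by exact_mod_cast hL
  have hq1 := q_one_lt (q := q)
  rcases hG.eq_or_lt with h0 | hG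
  · subst h0
    have : ∀ x, qPsi (qFF F L l a x) (qFF F L l a' x) = 0 := by
      intro x
      have h1 := qFF_sq_le (F := F) (L := L) l a x
      have h2 := hg x
      have h3 : ‖qFF F L l a x‖ ^ 2 ≤ 0 := h1.trans (by
        apply mul_nonpos_of_nonneg_of_nonpos (by positivity) h2)
      have h4 : ‖qFF F L l a x‖ ^ 2 = 0 := le_antisymm h3 (by positivity)
      unfold qPsi
      rw [h4]; ring
    simp [this]
  set E := ∑ b ∈ Finset.range (q ^ L), ∫ x, ‖F b x‖ ^ 2 ∂ν with hE
  have hE0 : 0 ≤ E := Finset.sum_nonneg fun b _ => integral_nonneg fun x => by positivity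
  set γ := Real.sqrt G / (q : ℝ) ^ (2 * L) with hγ
  have hγ0 : 0 < γ := div_pos (Real.sqrt_pos.2 hG) (by positivity)
  have n1 : ∀ i ∈ Finset.range (3 * L + 1), Integrable (fun x =>
      qPsiG q (γ * (q : ℝ) ^ i) (qFF F L l a x) (qFF F L l a' x)) ν := fun i _ =>
    (qPsiG_nice _ _ (qFF_nice hF l a) (qFF_nice hF l a')).int ν
  have n3 : ∀ b ∈ Finset.range (q ^ L), Integrable (fun x => ‖F b x‖ ^ 2) ν := fun b _ =>
    ((hF.nice b).npow two_ne_zero).int ν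
  have n2 : Integrable (fun x => G ^ 2 * ∑ b ∈ Finset.range (q ^ L), ‖F b x‖ ^ 2) ν :=
    (integrable_finsetSum _ n3).const_mul _
  have h1 := integral_mono ((qPsi_nice (qFF_nice hF l a) (qFF_nice hF l a')).int ν)
    ((integrable_finsetSum _ n1).add n2) (fun x => qPsi_le_sum hG hL x (hg x))
  refine h1.trans ?_
  show ∫ x, (∑ i ∈ Finset.range (3 * L + 1),
        qPsiG q (γ * (q : ℝ) ^ i) (qFF F L l a x) (qFF F L l a' x)
      + G ^ 2 * ∑ b ∈ Finset.range (q ^ L), ‖F b x‖ ^ 2) ∂ν ≤ _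
  rw [integral_add (integrable_finsetSum _ n1) n2, integral_finsetSum _ n1, integral_const_mul,
    integral_finsetSum _ n3, ← hE]
  have h2 := Finset.sum_le_sum fun i (_ : i ∈ Finset.range (3 * L + 1)) =>
    level_lemma ν hq2 hχ hF (γ := γ * (q : ℝ) ^ i) (by positivity) hG hL hl ha ha' haa hg hz
  rw [← hE, Finset.sum_const, Finset.card_range, nsmul_eq_mul] at h2
  push_cast at h2
  have h3 : (3 * (L : ℝ) + 1) * (4864 * (q : ℝ) ^ 4 * (L : ℝ) ^ 5 * G ^ 2 * E)
      ≤ (4 * L) * (4864 * (q : ℝ) ^ 4 * (L : ℝ) ^ 5 * G ^ 2 * E) := by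
    gcongr
    linarith
  have h4 : G ^ 2 * E ≤ (G ^ 2 * E) * ((q : ℝ) ^ 4 * (L : ℝ) ^ 6) :=
    le_mul_of_one_le_right (by positivity)
      (one_le_mul_of_one_le_of_one_le (one_le_pow₀ hq1.le) (one_le_pow₀ hL'))
  nlinarith

open scoped Classical in
/-- The version localized to the two intervals. -/
theorem bil_local (hq2 : q ≠ 2) (hχ : QChr q χ) (hF : QSys χ L F) {G : ℝ}
    (hL : 1 ≤ L) {l a a' : ℕ} (hl : l ≤ L)
    (ha : a < q ^ l) (ha' : a' < q ^ l) (haa : a ≠ a')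
    (hg : ∀ x, ∑ b ∈ Finset.range (q ^ L), ‖F b x‖ ^ 2 ≤ G) :
    ∫ x, qPsi (qFF F L l a x) (qFF F L l a' x) ∂ν ≤
      20000 * (q : ℝ) ^ 4 * (L : ℝ) ^ 6 * G ^ 2 *
        (∑ b ∈ qdesc q L l a, ∫ x, ‖F b x‖ ^ 2 ∂ν + ∑ b ∈ qdesc q L l a', ∫ x, ‖F b x‖ ^ 2 ∂ν) := by
  have hG : 0 ≤ G := le_trans (Finset.sum_nonneg fun b _ => by positivity) (hg 0)
  set F' : ℕ → ℚ_[q] × ℚ_[q] → ℂ := fun b =>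
    if b % q ^ l = a ∨ b % q ^ l = a' then F b else fun _ => 0 with hF'
  have hs : QSys χ L F' := by
    refine ⟨fun b => ?_, fun b => ?_⟩
    · simp only [hF']; split_ifs
      · exact hF.nice b
      · exact QNice.zero
    · simp only [hF']; split_ifs
      · exact hF.w b
      · exact QW.zero
  have hle : ∀ b x, ‖F' b x‖ ≤ ‖F b x‖ := by
    intro b x
    simp only [hF']; split_ifs
    · exact le_rfl
    · simp
  have hg' : ∀ x, ∑ b ∈ Finset.range (q ^ L), ‖F' b x‖ ^ 2 ≤ G := fun x =>
    (Finset.sum_le_sum fun b _ => by gcongr; exact hle b x).trans (hg x)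
  have e1 : ∀ x, qFF F' L l a x = qFF F L l a x := fun x =>
    Finset.sum_congr rfl fun b hb => by
      simp only [hF']; rw [if_pos (Or.inl (Finset.mem_filter.1 hb).2)]
  have e2 : ∀ x, qFF F' L l a' x = qFF F L l a' x := fun x =>
    Finset.sum_congr rfl fun b hb => by
      simp only [hF']; rw [if_pos (Or.inr (Finset.mem_filter.1 hb).2)]
  have hρ := norm_sub_gt_of_ne ha' ha haa.symm
  have hz : ∀ b : ℕ, ‖(a : ℚ_[q]) - (a' : ℚ_[q])‖ < ‖(b : ℚ_[q]) - (a : ℚ_[q])‖ →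
      F' b = fun _ => 0 := by
    intro b hb
    simp only [hF']
    rw [if_neg]
    rintro (h | h)
    · have := (norm_sub_le_iff (q := q) a b l).2 (by rw [h, Nat.mod_eq_of_lt ha])
      linarith
    · have h1 := (norm_sub_le_iff (q := q) a' b l).2 (by rw [h, Nat.mod_eq_of_lt ha'])
      have h2 : (b : ℚ_[q]) - (a : ℚ_[q])
          = ((b : ℚ_[q]) - (a' : ℚ_[q])) + ((a' : ℚ_[q]) - (a : ℚ_[q])) := by ring
      have h3 := nonarch2 (h1.trans hρ.le) (y := (a' : ℚ_[q]) - (a : ℚ_[q]))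
        (norm_sub_rev _ _).le
      rw [← h2] at h3
      linarith
  have hb := bil_full ν hq2 hχ hs hG hL hl ha ha' haa hg' hz
  simp only [e1, e2] at hb
  refine hb.trans ?_
  gcongr
  unfold qdesc
  rw [Finset.sum_filter, Finset.sum_filter, ← Finset.sum_add_distrib]
  refine Finset.sum_le_sum fun b _ => ?_
  have i0 : 0 ≤ ∫ x, ‖F b x‖ ^ 2 ∂ν := integral_nonneg fun x => by positivity
  simp only [hF']
  by_cases h1 : b % q ^ l = a <;> by_cases h2 : b % q ^ l = a' <;> simp [h1, h2, i0, haa, haa.symm]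

end bilinear3

/-! ### The linear estimate and the sum over pairs -/

theorem six_ptw (n : ℕ) (z : ℕ → ℂ) {e : ℝ} (he : 0 < e) :
    ‖∑ i ∈ Finset.range n, z i‖ ^ 6 ≤ (1 + e) ^ 6 * ∑ i ∈ Finset.range n, ‖z i‖ ^ 6
      + (n : ℝ) ^ 10 / e ^ 4 * ∑ i ∈ Finset.range n, ∑ j ∈ Finset.range n,
        if i ≠ j then qPsi (z i) (z j) else 0 := by
  rcases Nat.eq_zero_or_pos n with rfl | hn
  · simp
  have hn0 : (0 : ℝ) < n := by exact_mod_cast hn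
  have hpsi : ∀ i ∈ Finset.range n, ∀ j ∈ Finset.range n,
      0 ≤ if i ≠ j then qPsi (z i) (z j) else 0 := by
    intro i _ j _
    split_ifs
    · exact qPsi_nonneg _ _
    · exact le_rfl
  have hpsi2 : ∀ i ∈ Finset.range n, 0 ≤ ∑ j ∈ Finset.range n,
      if i ≠ j then qPsi (z i) (z j) else 0 := fun i hi => Finset.sum_nonneg (hpsi i hi)
  obtain ⟨k, hk, hmax⟩ := Finset.exists_max_image (Finset.range n) (fun i => ‖z i‖)
    ⟨0, Finset.mem_range.2 hn⟩
  by_cases hex : ∃ i ∈ Finset.range n, k ≠ i ∧ e * ‖z k‖ < n * ‖z i‖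
  · obtain ⟨i, hi, hki, hlt⟩ := hex
    have h1 : ‖∑ i ∈ Finset.range n, z i‖ ≤ n * ‖z k‖ := by
      refine (norm_sum_le _ _).trans ?_
      refine (Finset.sum_le_sum hmax).trans ?_
      simp
    have h2 : ‖z k‖ ≤ n * ‖z i‖ / e := by
      rw [le_div_iff₀ he]; linarith
    have h3 : qPsi (z k) (z i) = ‖z k‖ ^ 2 * ‖z i‖ ^ 4 := by
      unfold qPsi
      rw [min_eq_right (hmax i hi)]; ring
    have h4 : (n : ℝ) ^ 10 / e ^ 4 * qPsi (z k) (z i) ≤ (n : ℝ) ^ 10 / e ^ 4 *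
        ∑ i ∈ Finset.range n, ∑ j ∈ Finset.range n, if i ≠ j then qPsi (z i) (z j) else 0 := by
      gcongr
      have s1 := Finset.single_le_sum (hpsi k hk) hi
      have s2 := Finset.single_le_sum hpsi2 hk
      simp only [if_pos hki] at s1
      exact s1.trans s2
    have h5 : 0 ≤ (1 + e) ^ 6 * ∑ i ∈ Finset.range n, ‖z i‖ ^ 6 := by positivity
    have h6 : ‖∑ i ∈ Finset.range n, z i‖ ^ 6 ≤ (n : ℝ) ^ 10 / e ^ 4 * qPsi (z k) (z i) := by
      calc ‖∑ i ∈ Finset.range n, z i‖ ^ 6 ≤ (n * ‖z k‖) ^ 6 := by gcongr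
        _ = (n : ℝ) ^ 6 * ‖z k‖ ^ 2 * ‖z k‖ ^ 4 := by ring
        _ ≤ (n : ℝ) ^ 6 * ‖z k‖ ^ 2 * (n * ‖z i‖ / e) ^ 4 := by gcongr
        _ = _ := by rw [h3]; field_simp
    linarith
  · push Not at hex
    have h1 : ‖∑ i ∈ Finset.range n, z i‖ ≤ (1 + e) * ‖z k‖ := by
      rw [← Finset.add_sum_erase _ _ hk]
      refine (norm_add_le _ _).trans ?_
      have : ‖∑ i ∈ (Finset.range n).erase k, z i‖ ≤ e * ‖z k‖ := by
        refine (norm_sum_le _ _).trans ?_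
        have h2 : ∀ i ∈ (Finset.range n).erase k, ‖z i‖ ≤ e * ‖z k‖ / n := by
          intro i hi
          rw [Finset.mem_erase] at hi
          rw [le_div_iff₀ hn0]
          linarith [hex i hi.2 hi.1.symm]
        refine (Finset.sum_le_card_nsmul _ _ _ h2).trans ?_
        rw [nsmul_eq_mul]
        have h3 : (((Finset.range n).erase k).card : ℝ) ≤ n := by
          have := Finset.card_erase_le (s := Finset.range n) (a := k)
          rw [Finset.card_range] at this
          exact_mod_cast this
        calc _ ≤ (n : ℝ) * (e * ‖z k‖ / n) := by gcongr
          _ = _ := by field_simp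
      linarith
    have h2 : ‖z k‖ ^ 6 ≤ ∑ i ∈ Finset.range n, ‖z i‖ ^ 6 :=
      Finset.single_le_sum (f := fun i => ‖z i‖ ^ 6) (fun _ _ => by positivity) hk
    have h3 : 0 ≤ (n : ℝ) ^ 10 / e ^ 4 * ∑ i ∈ Finset.range n, ∑ j ∈ Finset.range n,
        if i ≠ j then qPsi (z i) (z j) else 0 :=
      mul_nonneg (by positivity) (Finset.sum_nonneg hpsi2)
    calc _ ≤ ((1 + e) * ‖z k‖) ^ 6 := by gcongr
      _ = (1 + e) ^ 6 * ‖z k‖ ^ 6 := by ring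
      _ ≤ (1 + e) ^ 6 * ∑ i ∈ Finset.range n, ‖z i‖ ^ 6 := by gcongr
      _ ≤ _ := by linarith

theorem three_ptw_aux {M x y : ℝ} (hM : 0 < M) (hx : 0 ≤ x) (hxy : x ≤ y) :
    (x * y) ^ 3 ≤ M * (x ^ 2 * y ^ 2 * x ^ 2) + (M ^ 3)⁻¹ * (x ^ 6 + y ^ 6) := by
  have hy := hx.trans hxy
  by_cases h : y ≤ M * x
  · have h1 : (x * y) ^ 3 ≤ M * (x ^ 2 * y ^ 2 * x ^ 2) := by
      calc (x * y) ^ 3 = x ^ 3 * y ^ 2 * y := by ring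
        _ ≤ x ^ 3 * y ^ 2 * (M * x) := by gcongr
        _ = _ := by ring
    have : 0 ≤ (M ^ 3)⁻¹ * (x ^ 6 + y ^ 6) := by positivity
    linarith
  · push Not at h
    have h1 : (M * x) ^ 3 ≤ y ^ 3 := by gcongr
    have h2 : x ^ 3 * y ^ 3 ≤ (M ^ 3)⁻¹ * y ^ 6 := by
      rw [inv_mul_eq_div, le_div_iff₀ (by positivity)]
      calc x ^ 3 * y ^ 3 * M ^ 3 = (M * x) ^ 3 * y ^ 3 := by ring
        _ ≤ y ^ 3 * y ^ 3 := by gcongr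
        _ = _ := by ring
    have h3 : 0 ≤ M * (x ^ 2 * y ^ 2 * x ^ 2) := by positivity
    have h4 : 0 ≤ (M ^ 3)⁻¹ * x ^ 6 := by positivity
    rw [mul_pow, mul_add]
    linarith

theorem three_ptw {M : ℝ} (hM : 0 < M) (z w : ℂ) :
    ‖z * w‖ ^ 3 ≤ M * qPsi z w + (M ^ 3)⁻¹ * (‖z‖ ^ 6 + ‖w‖ ^ 6) := by
  unfold qPsi
  rw [norm_mul]
  rcases le_total ‖z‖ ‖w‖ with h | h
  · rw [min_eq_left h]
    exact three_ptw_aux hM (norm_nonneg _) h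
  · rw [min_eq_right h]
    have := three_ptw_aux hM (norm_nonneg _) h
    rw [mul_comm ‖z‖, add_comm (‖z‖ ^ 6), mul_comm (‖z‖ ^ 2)]
    exact this

theorem one_add_inv_pow {L : ℕ} (hL : 1 ≤ L) : ((1 + 1 / (L : ℝ)) ^ 6) ^ L ≤ 729 := by
  have hL' : (0 : ℝ) < L := by exact_mod_cast hL
  have h1 : 1 + 1 / (L : ℝ) ≤ Real.exp (1 / L) := by
    have := Real.add_one_le_exp (1 / (L : ℝ))
    linarith
  have h2 : (1 + 1 / (L : ℝ)) ^ L ≤ 3 := by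
    calc (1 + 1 / (L : ℝ)) ^ L ≤ Real.exp (1 / L) ^ L := by gcongr
      _ = Real.exp 1 := by rw [← Real.exp_nat_mul]; congr 1; field_simp
      _ ≤ 3 := by linarith [Real.exp_one_lt_d9]
  rw [← pow_mul, mul_comm, pow_mul]
  calc _ ≤ (3 : ℝ) ^ 6 := by gcongr
    _ = _ := by norm_num

section linear
variable {q : ℕ} [Fact q.Prime] {χ : ℚ_[q] → ℂ}
variable {F : ℕ → ℚ_[q] × ℚ_[q] → ℂ} {L : ℕ}

theorem qdesc_sum_children {E : Type*} [AddCommMonoid E] (φ : ℕ → E) {l a : ℕ} (ha : a < q ^ l) :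
    ∑ b ∈ qdesc q L l a, φ b
      = ∑ i ∈ Finset.range q, ∑ b ∈ qdesc q L (l + 1) (a + i * q ^ l), φ b := by
  have hq : 0 < q := (Fact.out : q.Prime).pos
  have hql : 0 < q ^ l := by positivity
  rw [← Finset.sum_fiberwise_of_maps_to (s := qdesc q L l a) (t := Finset.range q)
    (g := fun b => b / q ^ l % q) (fun b _ => Finset.mem_range.2 (Nat.mod_lt _ hq))]
  refine Finset.sum_congr rfl fun i hi => Finset.sum_congr ?_ fun _ _ => rfl
  rw [Finset.mem_range] at hi
  ext b
  simp only [qdesc, Finset.mem_filter, Finset.mem_range, and_assoc]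
  refine and_congr_right fun _ => ?_
  rw [pow_succ, Nat.mod_mul]
  constructor
  · rintro ⟨h1, h2⟩
    rw [h1, h2, mul_comm]
  · intro h
    have h1 : b % q ^ l = a := by
      have := congrArg (· % q ^ l) h
      simpa [Nat.mod_eq_of_lt ha] using this
    refine ⟨h1, ?_⟩
    rw [h1, mul_comm i] at h
    exact Nat.eq_of_mul_eq_mul_left hql (by omega)

theorem qdesc_sum_all {E : Type*} [AddCommMonoid E] (φ : ℕ → E) (l : ℕ) :
    ∑ a ∈ Finset.range (q ^ l), ∑ b ∈ qdesc q L l a, φ b = ∑ b ∈ Finset.range (q ^ L), φ b := by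
  have hq : 0 < q := (Fact.out : q.Prime).pos
  exact Finset.sum_fiberwise_of_maps_to (s := Finset.range (q ^ L)) (t := Finset.range (q ^ l))
    (g := fun b => b % q ^ l) (fun b _ => Finset.mem_range.2 (Nat.mod_lt _ (by positivity))) φ

theorem qFF_children {l a : ℕ} (ha : a < q ^ l) (x : ℚ_[q] × ℚ_[q]) :
    qFF F L l a x = ∑ i ∈ Finset.range q, qFF F L (l + 1) (a + i * q ^ l) x :=
  qdesc_sum_children _ ha

variable (ν : Measure (ℚ_[q] × ℚ_[q])) [ν.IsAddHaarMeasure]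

theorem psi_if_nice (P : Prop) [Decidable P] {A B : ℚ_[q] × ℚ_[q] → ℂ} (hA : QNice A)
    (hB : QNice B) : QNice (fun x => if P then qPsi (A x) (B x) else 0) := by
  by_cases h : P
  · simp only [if_pos h]; exact qPsi_nice hA hB
  · simp only [if_neg h]; exact QNice.zero

theorem lin_step (hq2 : q ≠ 2) (hχ : QChr q χ) (hF : QSys χ L F) {G : ℝ}
    (hL : 1 ≤ L) {l : ℕ} (hl : l < L)
    (hg : ∀ x, ∑ b ∈ Finset.range (q ^ L), ‖F b x‖ ^ 2 ≤ G) :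
    ∑ a ∈ Finset.range (q ^ l), ∫ x, ‖qFF F L l a x‖ ^ 6 ∂ν ≤
      (1 + 1 / (L : ℝ)) ^ 6 * ∑ a ∈ Finset.range (q ^ (l + 1)), ∫ x, ‖qFF F L (l + 1) a x‖ ^ 6 ∂ν
      + 40000 * (q : ℝ) ^ 15 * (L : ℝ) ^ 10 * G ^ 2 *
        ∑ b ∈ Finset.range (q ^ L), ∫ x, ‖F b x‖ ^ 2 ∂ν := by
  have hL' : (0 : ℝ) < L := by exact_mod_cast hL
  set e : ℕ → ℝ := fun b => ∫ x, ‖F b x‖ ^ 2 ∂ν with he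
  set Ed : ℕ → ℝ := fun c => ∑ b ∈ qdesc q L (l + 1) c, e b with hEd
  have he0 : ∀ b, 0 ≤ e b := fun b => integral_nonneg fun x => by positivity
  have hEd0 : ∀ b, 0 ≤ Ed b := fun b => Finset.sum_nonneg fun c _ => he0 c
  have hone : ∀ a ∈ Finset.range (q ^ l), ∫ x, ‖qFF F L l a x‖ ^ 6 ∂ν ≤
      (1 + 1 / (L : ℝ)) ^ 6 * ∑ i ∈ Finset.range q, ∫ x, ‖qFF F L (l + 1) (a + i * q ^ l) x‖ ^ 6 ∂ν
      + 40000 * (q : ℝ) ^ 15 * (L : ℝ) ^ 10 * G ^ 2 *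
        ∑ i ∈ Finset.range q, Ed (a + i * q ^ l) := by
    intro a ha
    rw [Finset.mem_range] at ha
    have n1 : ∀ i ∈ Finset.range q,
        Integrable (fun x => ‖qFF F L (l + 1) (a + i * q ^ l) x‖ ^ 6) ν := fun i _ =>
      ((qFF_nice hF _ _).npow (by norm_num)).int ν
    have n2 : ∀ i ∈ Finset.range q, ∀ j ∈ Finset.range q, Integrable (fun x =>
        if i ≠ j then qPsi (qFF F L (l + 1) (a + i * q ^ l) x)
          (qFF F L (l + 1) (a + j * q ^ l) x) else 0) ν := fun i _ j _ =>
      (psi_if_nice _ (qFF_nice hF _ _) (qFF_nice hF _ _)).int ν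
    have n3 : ∀ i ∈ Finset.range q, Integrable (fun x => ∑ j ∈ Finset.range q,
        if i ≠ j then qPsi (qFF F L (l + 1) (a + i * q ^ l) x)
          (qFF F L (l + 1) (a + j * q ^ l) x) else 0) ν := fun i hi =>
      integrable_finsetSum _ (n2 i hi)
    have hm := integral_mono (((qFF_nice hF l a).npow (n := 6) (by norm_num)).int ν)
      (((integrable_finsetSum _ n1).const_mul ((1 + 1 / (L : ℝ)) ^ 6)).add
        ((integrable_finsetSum _ n3).const_mul ((q : ℝ) ^ 10 / (1 / (L : ℝ)) ^ 4)))
      (fun x => by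
        have := six_ptw q (fun i => qFF F L (l + 1) (a + i * q ^ l) x) (e := 1 / (L : ℝ))
          (by positivity)
        rw [← qFF_children ha] at this
        exact this)
    refine hm.trans ?_
    rw [integral_add' ((integrable_finsetSum _ n1).const_mul _)
      ((integrable_finsetSum _ n3).const_mul _), integral_const_mul, integral_const_mul,
      integral_finsetSum _ n1, integral_finsetSum _ n3]
    refine add_le_add le_rfl ?_
    have hb : ∀ i ∈ Finset.range q, ∫ x, (∑ j ∈ Finset.range q,
        if i ≠ j then qPsi (qFF F L (l + 1) (a + i * q ^ l) x)
          (qFF F L (l + 1) (a + j * q ^ l) x) else 0) ∂ν ≤ ∑ j ∈ Finset.range q,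
          20000 * (q : ℝ) ^ 4 * (L : ℝ) ^ 6 * G ^ 2 * (Ed (a + i * q ^ l) + Ed (a + j * q ^ l)) := by
      intro i hi
      rw [integral_finsetSum _ (n2 i hi)]
      refine Finset.sum_le_sum fun j hj => ?_
      have hi' := Finset.mem_range.1 hi
      have hj' := Finset.mem_range.1 hj
      by_cases hij : i = j
      · simp only [hij, ne_eq, not_true_eq_false, if_false, integral_zero]
        have := hEd0 (a + j * q ^ l)
        positivity
      · simp only [ne_eq, hij, not_false_eq_true, if_true]
        exact bil_local ν hq2 hχ hF hL (by omega) (child_lt ha hi') (child_lt ha hj')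
          (child_ne hij) hg
    have hs := Finset.sum_le_sum hb
    have e1 : ∑ i ∈ Finset.range q, ∑ j ∈ Finset.range q,
          20000 * (q : ℝ) ^ 4 * (L : ℝ) ^ 6 * G ^ 2 * (Ed (a + i * q ^ l) + Ed (a + j * q ^ l))
        = 40000 * (q : ℝ) ^ 5 * (L : ℝ) ^ 6 * G ^ 2 * ∑ i ∈ Finset.range q, Ed (a + i * q ^ l) := by
      simp only [← Finset.mul_sum, Finset.sum_add_distrib, Finset.sum_const, Finset.card_range,
        nsmul_eq_mul]
      ring
    rw [e1] at hs
    calc _ ≤ (q : ℝ) ^ 10 / (1 / (L : ℝ)) ^ 4 * (40000 * (q : ℝ) ^ 5 * (L : ℝ) ^ 6 * G ^ 2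
          * ∑ i ∈ Finset.range q, Ed (a + i * q ^ l)) := by gcongr
      _ = _ := by field_simp
  refine (Finset.sum_le_sum hone).trans (le_of_eq ?_)
  rw [Finset.sum_add_distrib, ← Finset.mul_sum, ← Finset.mul_sum,
    ← sum_range_succ_level q l (fun c => ∫ x, ‖qFF F L (l + 1) c x‖ ^ 6 ∂ν),
    ← sum_range_succ_level q l Ed, hEd, qdesc_sum_all]

theorem lin_all (hq2 : q ≠ 2) (hχ : QChr q χ) (hF : QSys χ L F) {G : ℝ}
    (hL : 1 ≤ L) (hg : ∀ x, ∑ b ∈ Finset.range (q ^ L), ‖F b x‖ ^ 2 ≤ G) (n l : ℕ)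
    (hn : n + l = L) :
    ∑ a ∈ Finset.range (q ^ l), ∫ x, ‖qFF F L l a x‖ ^ 6 ∂ν ≤
      ((1 + 1 / (L : ℝ)) ^ 6) ^ n * ((1 + 40000 * n * (q : ℝ) ^ 15 * (L : ℝ) ^ 10) * G ^ 2 *
        ∑ b ∈ Finset.range (q ^ L), ∫ x, ‖F b x‖ ^ 2 ∂ν) := by
  have hL' : (0 : ℝ) < L := by exact_mod_cast hL
  have hG : 0 ≤ G := le_trans (Finset.sum_nonneg fun b _ => by positivity) (hg 0)
  have hE0 : 0 ≤ ∑ b ∈ Finset.range (q ^ L), ∫ x, ‖F b x‖ ^ 2 ∂ν :=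
    Finset.sum_nonneg fun b _ => integral_nonneg fun x => by positivity
  induction n generalizing l with
  | zero =>
    obtain rfl : l = L := by omega
    simp only [pow_zero, one_mul, Nat.cast_zero, mul_zero, zero_mul, add_zero]
    rw [Finset.mul_sum]
    refine Finset.sum_le_sum fun a ha => ?_
    rw [← integral_const_mul]
    have e : ∀ x, qFF F l l a x = F a x := fun x => by
      rw [qFF, qdesc_self (Finset.mem_range.1 ha), Finset.sum_singleton]
    simp only [e]
    refine integral_mono (((hF.nice a).npow (by norm_num)).int ν)
      ((((hF.nice a).npow two_ne_zero).int ν).const_mul _) fun x => ?_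
    have h1 : ‖F a x‖ ^ 2 ≤ G := le_trans (Finset.single_le_sum (f := fun b => ‖F b x‖ ^ 2)
      (fun _ _ => by positivity) ha) (hg x)
    calc ‖F a x‖ ^ 6 = (‖F a x‖ ^ 2) ^ 2 * ‖F a x‖ ^ 2 := by ring
      _ ≤ G ^ 2 * ‖F a x‖ ^ 2 := by gcongr
  | succ n ih =>
    have h1 := lin_step ν hq2 hχ hF hL (l := l) (by omega) hg
    have h2 := ih (l + 1) (by omega)
    set E := ∑ b ∈ Finset.range (q ^ L), ∫ x, ‖F b x‖ ^ 2 ∂ν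
    set ρ := (1 + 1 / (L : ℝ)) ^ 6 with hρ
    have hρ1 : 1 ≤ ρ := one_le_pow₀ (by
      have : 0 ≤ 1 / (L : ℝ) := by positivity
      linarith)
    have h3 : 40000 * (q : ℝ) ^ 15 * (L : ℝ) ^ 10 * G ^ 2 * E
        ≤ ρ ^ (n + 1) * (40000 * (q : ℝ) ^ 15 * (L : ℝ) ^ 10 * G ^ 2 * E) :=
      le_mul_of_one_le_left (by positivity) (one_le_pow₀ hρ1)
    have h4 : ρ * ∑ a ∈ Finset.range (q ^ (l + 1)), ∫ x, ‖qFF F L (l + 1) a x‖ ^ 6 ∂ν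
        ≤ ρ * (ρ ^ n * ((1 + 40000 * n * (q : ℝ) ^ 15 * (L : ℝ) ^ 10) * G ^ 2 * E)) := by gcongr
    refine (h1.trans (add_le_add h4 h3)).trans (le_of_eq ?_)
    push_cast
    ring

theorem lin_final (hq2 : q ≠ 2) (hχ : QChr q χ) (hF : QSys χ L F) {G : ℝ}
    (hL : 1 ≤ L) (hg : ∀ x, ∑ b ∈ Finset.range (q ^ L), ‖F b x‖ ^ 2 ≤ G) {l : ℕ}
    (hl : l ≤ L) :
    ∑ a ∈ Finset.range (q ^ l), ∫ x, ‖qFF F L l a x‖ ^ 6 ∂ν ≤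
      30000000 * (q : ℝ) ^ 15 * (L : ℝ) ^ 11 * G ^ 2 *
        ∑ b ∈ Finset.range (q ^ L), ∫ x, ‖F b x‖ ^ 2 ∂ν := by
  have hL' : (1 : ℝ) ≤ L := by exact_mod_cast hL
  have hq1 := q_one_lt (q := q)
  have hG : 0 ≤ G := le_trans (Finset.sum_nonneg fun b _ => by positivity) (hg 0)
  have hE0 : 0 ≤ ∑ b ∈ Finset.range (q ^ L), ∫ x, ‖F b x‖ ^ 2 ∂ν :=
    Finset.sum_nonneg fun b _ => integral_nonneg fun x => by positivity
  have h1 := lin_all ν hq2 hχ hF hL hg (L - l) l (by omega)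
  set E := ∑ b ∈ Finset.range (q ^ L), ∫ x, ‖F b x‖ ^ 2 ∂ν
  have h2 : ((L - l : ℕ) : ℝ) ≤ L := by exact_mod_cast Nat.sub_le _ _
  have hρ1 : 1 ≤ (1 + 1 / (L : ℝ)) ^ 6 := one_le_pow₀ (by
      have : 0 ≤ 1 / (L : ℝ) := by positivity
      linarith)
  have h3 : ((1 + 1 / (L : ℝ)) ^ 6) ^ (L - l) ≤ 729 :=
    (pow_le_pow_right₀ hρ1 (Nat.sub_le _ _)).trans (one_add_inv_pow hL)
  have h4 : (1 : ℝ) ≤ (q : ℝ) ^ 15 * (L : ℝ) ^ 11 :=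
    one_le_mul_of_one_le_of_one_le (one_le_pow₀ hq1.le) (one_le_pow₀ hL')
  refine h1.trans ?_
  calc _ ≤ 729 * ((1 + 40000 * L * (q : ℝ) ^ 15 * (L : ℝ) ^ 10) * G ^ 2 * E) := by gcongr
    _ ≤ 729 * (((q : ℝ) ^ 15 * (L : ℝ) ^ 11 + 40000 * L * (q : ℝ) ^ 15 * (L : ℝ) ^ 10) * G ^ 2 * E) := by
      gcongr
    _ = (729 * 40001) * ((q : ℝ) ^ 15 * (L : ℝ) ^ 11 * G ^ 2 * E) := by ring
    _ ≤ 30000000 * ((q : ℝ) ^ 15 * (L : ℝ) ^ 11 * G ^ 2 * E) := by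
      gcongr
      norm_num
    _ = _ := by ring

theorem pairs_final (hq2 : q ≠ 2) (hχ : QChr q χ) (hF : QSys χ L F) {G : ℝ}
    (hL : 1 ≤ L) (hg : ∀ x, ∑ b ∈ Finset.range (q ^ L), ‖F b x‖ ^ 2 ≤ G) {l : ℕ}
    (hl : l ≤ L) :
    ∑ a ∈ Finset.range (q ^ l), ∑ a' ∈ Finset.range (q ^ l),
      (if a ≠ a' then ∫ x, ‖qFF F L l a x * qFF F L l a' x‖ ^ 3 ∂ν else 0) ≤
      100000000 * (q : ℝ) ^ 15 * (L : ℝ) ^ 8 * (q : ℝ) ^ l * G ^ 2 *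
        ∑ b ∈ Finset.range (q ^ L), ∫ x, ‖F b x‖ ^ 2 ∂ν := by
  have hL' : (1 : ℝ) ≤ L := by exact_mod_cast hL
  have hL0 : (0 : ℝ) < L := by linarith
  have hq1 := q_one_lt (q := q)
  set e : ℕ → ℝ := fun b => ∫ x, ‖F b x‖ ^ 2 ∂ν with he
  set Ed : ℕ → ℝ := fun c => ∑ b ∈ qdesc q L l c, e b with hEd
  set X : ℕ → ℝ := fun c => ∫ x, ‖qFF F L l c x‖ ^ 6 ∂ν with hX
  have he0 : ∀ b, 0 ≤ e b := fun b => integral_nonneg fun x => by positivity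
  have hX0 : ∀ b, 0 ≤ X b := fun b => integral_nonneg fun x => by positivity
  have hEd0 : ∀ b, 0 ≤ Ed b := fun b => Finset.sum_nonneg fun c _ => he0 c
  have h1 : ∀ a ∈ Finset.range (q ^ l), ∀ a' ∈ Finset.range (q ^ l),
      (if a ≠ a' then ∫ x, ‖qFF F L l a x * qFF F L l a' x‖ ^ 3 ∂ν else 0)
      ≤ L * (20000 * (q : ℝ) ^ 4 * (L : ℝ) ^ 6 * G ^ 2 * (Ed a + Ed a'))
        + ((L : ℝ) ^ 3)⁻¹ * (X a + X a') := by
    intro a ha a' ha'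
    rw [Finset.mem_range] at ha ha'
    have p1 := hEd0 a
    have p2 := hEd0 a'
    have p3 := hX0 a
    have p4 := hX0 a'
    by_cases haa : a = a'
    · rw [if_neg (by simpa using haa)]
      positivity
    · rw [if_pos haa]
      have n1 := (qPsi_nice (qFF_nice hF l a) (qFF_nice hF l a')).int ν
      have n2 : ∀ c, Integrable (fun x => ‖qFF F L l c x‖ ^ 6) ν := fun c =>
        ((qFF_nice hF l c).npow (by norm_num)).int ν
      have hm := integral_mono (((((qFF_nice hF l a).mul (qFF_nice hF l a')).npow (n := 3)
        (by norm_num))).int ν) ((n1.const_mul (L : ℝ)).add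
          (((n2 a).add (n2 a')).const_mul ((L : ℝ) ^ 3)⁻¹)) (fun x => three_ptw hL0 _ _)
      rw [integral_add' (n1.const_mul _) (((n2 a).add (n2 a')).const_mul _), integral_const_mul,
        integral_const_mul, integral_add' (n2 a) (n2 a')] at hm
      refine hm.trans (add_le_add ?_ le_rfl)
      gcongr
      exact bil_local ν hq2 hχ hF hL hl ha ha' haa hg
  refine (Finset.sum_le_sum fun a ha => Finset.sum_le_sum (h1 a ha)).trans ?_
  have hlin : ∑ a ∈ Finset.range (q ^ l), X a ≤ _ := lin_final ν hq2 hχ hF hL hg hl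
  have hsE : ∑ a ∈ Finset.range (q ^ l), Ed a = ∑ b ∈ Finset.range (q ^ L), e b :=
    qdesc_sum_all _ _
  have hE0 : 0 ≤ ∑ b ∈ Finset.range (q ^ L), e b := Finset.sum_nonneg fun c _ => he0 c
  change _ ≤ 30000000 * (q : ℝ) ^ 15 * (L : ℝ) ^ 11 * G ^ 2 * ∑ b ∈ Finset.range (q ^ L), e b at hlin
  set E := ∑ b ∈ Finset.range (q ^ L), e b
  have e1 : ∑ a ∈ Finset.range (q ^ l), ∑ a' ∈ Finset.range (q ^ l),
      (L * (20000 * (q : ℝ) ^ 4 * (L : ℝ) ^ 6 * G ^ 2 * (Ed a + Ed a'))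
        + ((L : ℝ) ^ 3)⁻¹ * (X a + X a'))
      = 40000 * (q : ℝ) ^ 4 * (L : ℝ) ^ 7 * (q : ℝ) ^ l * G ^ 2 * E
        + 2 * (q : ℝ) ^ l * (((L : ℝ) ^ 3)⁻¹ * ∑ a ∈ Finset.range (q ^ l), X a) := by
    simp only [← Finset.mul_sum, Finset.sum_add_distrib, Finset.sum_const, Finset.card_range,
        nsmul_eq_mul, hsE]
    push_cast
    ring
  rw [e1]
  have h5 : ((L : ℝ) ^ 3)⁻¹ * ∑ a ∈ Finset.range (q ^ l), X a
      ≤ 30000000 * (q : ℝ) ^ 15 * (L : ℝ) ^ 8 * G ^ 2 * E := by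
    calc _ ≤ ((L : ℝ) ^ 3)⁻¹ * (30000000 * (q : ℝ) ^ 15 * (L : ℝ) ^ 11 * G ^ 2 * E) := by gcongr
      _ = _ := by field_simp
  have h6 : (q : ℝ) ^ 4 * (L : ℝ) ^ 7 ≤ (q : ℝ) ^ 15 * (L : ℝ) ^ 8 := by
    gcongr
    · exact hq1.le
    · norm_num
    · norm_num
  calc _ ≤ 40000 * ((q : ℝ) ^ 15 * (L : ℝ) ^ 8) * (q : ℝ) ^ l * G ^ 2 * E
        + 2 * (q : ℝ) ^ l * (30000000 * (q : ℝ) ^ 15 * (L : ℝ) ^ 8 * G ^ 2 * E) := by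
        rw [mul_assoc 40000]
        gcongr
    _ = 60040000 * ((q : ℝ) ^ 15 * (L : ℝ) ^ 8 * (q : ℝ) ^ l * G ^ 2 * E) := by ring
    _ ≤ 100000000 * ((q : ℝ) ^ 15 * (L : ℝ) ^ 8 * (q : ℝ) ^ l * G ^ 2 * E) := by
        gcongr
        norm_num
    _ = _ := by ring

end linear

/-! ### Fourier side -/

section fourier
variable {q : ℕ} [Fact q.Prime] {χ : ℚ_[q] → ℂ}

theorem lc_of_inv {E : Type*} {φ : ℚ_[q] × ℚ_[q] → E} {c : ℝ} (hc : 0 < c)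
    (h : ∀ x t : ℚ_[q] × ℚ_[q], ‖t.1‖ ≤ c → ‖t.2‖ ≤ c → φ (x + t) = φ x) :
    IsLocallyConstant φ := by
  rw [IsLocallyConstant.iff_eventually_eq]
  intro x
  filter_upwards [Metric.closedBall_mem_nhds x hc] with y hy
  rw [mem_closedBall_iff_norm] at hy
  have := h x (y - x) ((norm_fst_le _).trans hy) ((norm_snd_le _).trans hy)
  rwa [add_sub_cancel] at this

theorem nice_of_inv {g : ℚ_[q] × ℚ_[q] → ℂ} {c d : ℝ} (hc : 0 < c)
    (hinv : ∀ x t : ℚ_[q] × ℚ_[q], ‖t.1‖ ≤ c → ‖t.2‖ ≤ c → g (x + t) = g x)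
    (hs : ∀ p : ℚ_[q] × ℚ_[q], ¬ (‖p.1‖ ≤ d ∧ ‖p.2‖ ≤ d) → g p = 0) : QNice g := by
  refine ⟨lc_of_inv hc hinv, HasCompactSupport.intro
    (isCompact_closedBall (0 : ℚ_[q] × ℚ_[q]) d) fun p hp => hs p fun h => hp ?_⟩
  rw [mem_closedBall_zero_iff]
  exact max_le h.1 h.2

variable (ν : Measure (ℚ_[q] × ℚ_[q])) [ν.IsAddHaarMeasure]

/-- The inverse Fourier integral. -/
noncomputable def qInv (χ : ℚ_[q] → ℂ) (g : ℚ_[q] × ℚ_[q] → ℂ) (x : ℚ_[q] × ℚ_[q]) : ℂ :=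
  ∫ p, g p * χ (p.1 * x.1 + p.2 * x.2) ∂ν

theorem chi_lc (hχ : QChr q χ) (x : ℚ_[q] × ℚ_[q]) :
    IsLocallyConstant (fun p : ℚ_[q] × ℚ_[q] => χ (p.1 * x.1 + p.2 * x.2)) := by
  refine lc_of_inv (c := (1 + ‖x‖)⁻¹) (by positivity) fun p t h1 h2 => hχ.congr ?_
  have e : (p + t).1 * x.1 + (p + t).2 * x.2 - (p.1 * x.1 + p.2 * x.2)
      = t.1 * x.1 + t.2 * x.2 := by
    simp only [Prod.fst_add, Prod.snd_add]; ring
  have hx : ‖x‖ ≤ 1 + ‖x‖ := by linarith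
  rw [e]
  apply nonarch2
  · rw [norm_mul]
    calc ‖t.1‖ * ‖x.1‖ ≤ (1 + ‖x‖)⁻¹ * (1 + ‖x‖) := by
          gcongr
          exact (norm_fst_le x).trans hx
      _ = 1 := inv_mul_cancel₀ (by positivity)
  · rw [norm_mul]
    calc ‖t.2‖ * ‖x.2‖ ≤ (1 + ‖x‖)⁻¹ * (1 + ‖x‖) := by
          gcongr
          exact (norm_snd_le x).trans hx
      _ = 1 := inv_mul_cancel₀ (by positivity)

theorem qInv_integrable (hχ : QChr q χ) {g : ℚ_[q] × ℚ_[q] → ℂ} (hg : QNice g)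
    (x : ℚ_[q] × ℚ_[q]) : Integrable (fun p => g p * χ (p.1 * x.1 + p.2 * x.2)) ν := by
  have := (QNice.lmul (chi_lc hχ x) hg).int ν
  simpa only [mul_comm] using this

theorem qInv_shift (hχ : QChr q χ) {g : ℚ_[q] × ℚ_[q] → ℂ} (x t : ℚ_[q] × ℚ_[q]) (z : ℚ_[q])
    (h : ∀ p, g p ≠ 0 → ‖p.1 * t.1 + p.2 * t.2 - z‖ ≤ 1) :
    qInv ν χ g (x + t) = χ z * qInv ν χ g x := by
  unfold qInv
  rw [← integral_const_mul]
  refine integral_congr_ae (Filter.Eventually.of_forall fun p => ?_)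
  simp only
  by_cases hp : g p = 0
  · rw [hp]; ring
  · have e : p.1 * (x + t).1 + p.2 * (x + t).2
        = (p.1 * x.1 + p.2 * x.2) + (p.1 * t.1 + p.2 * t.2) := by
      simp only [Prod.fst_add, Prod.snd_add]; ring
    rw [e, hχ.mul, hχ.congr (h p hp)]
    ring

theorem detect_small (hχ : QChr q χ) {z : ℚ_[q]} {K : ℕ} (hz : (q : ℝ) ^ K < ‖z‖) :
    ∃ h : ℚ_[q], ‖h‖ ≤ ((q : ℝ) ^ K)⁻¹ ∧ χ (z * h) ≠ 1 := by
  have hq := q_pos (q := q)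
  have hk : 0 < (q : ℝ) ^ K := by positivity
  have hn : ‖(q : ℚ_[q]) ^ (2 * K)‖ = ((q : ℝ) ^ (2 * K))⁻¹ := by
    rw [norm_pow, Padic.norm_p, inv_pow]
  obtain ⟨t, ht, hne⟩ := hχ.detect (z := z * (q : ℚ_[q]) ^ (2 * K)) (k := K) (by
    rw [norm_mul, hn]
    calc ((q : ℝ) ^ K)⁻¹ = (q : ℝ) ^ K * ((q : ℝ) ^ (2 * K))⁻¹ := by
          rw [two_mul, pow_add]; field_simp
      _ < _ := by gcongr)
  refine ⟨(q : ℚ_[q]) ^ (2 * K) * t, ?_, by rwa [← mul_assoc]⟩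
  rw [norm_mul, hn]
  calc _ ≤ ((q : ℝ) ^ (2 * K))⁻¹ * (q : ℝ) ^ K := by gcongr
    _ = _ := by rw [two_mul, pow_add]; field_simp

theorem qInv_nice (hχ : QChr q χ) {g : ℚ_[q] × ℚ_[q] → ℂ} {K : ℕ}
    (hinv : ∀ x t : ℚ_[q] × ℚ_[q], ‖t.1‖ ≤ ((q : ℝ) ^ K)⁻¹ → ‖t.2‖ ≤ ((q : ℝ) ^ K)⁻¹ →
      g (x + t) = g x)
    (hs : ∀ p : ℚ_[q] × ℚ_[q], ¬ (‖p.1‖ ≤ 1 ∧ ‖p.2‖ ≤ 1) → g p = 0) : QNice (qInv ν χ g) := by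
  have hq := q_pos (q := q)
  refine nice_of_inv (c := 1) (d := (q : ℝ) ^ K) one_pos ?_ ?_
  · intro x t h1 h2
    rw [qInv_shift ν hχ x t 0, hχ.zero, one_mul]
    intro p hp
    have hp' : ‖p.1‖ ≤ 1 ∧ ‖p.2‖ ≤ 1 := by
      by_contra hcon
      exact hp (hs p hcon)
    rw [sub_zero]
    apply nonarch2
    · rw [norm_mul]
      exact mul_le_one₀ hp'.1 (norm_nonneg _) h1
    · rw [norm_mul]
      exact mul_le_one₀ hp'.2 (norm_nonneg _) h2
  · intro x hx
    rw [not_and_or] at hx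
    push Not at hx
    rcases hx with hx | hx
    · obtain ⟨h, h1, h2⟩ := detect_small hχ hx
      refine integral_eq_zero_of_translate ν (h, 0) _ h2 fun p => ?_
      rw [hinv p (h, 0) h1 (by simp)]
      have e : (p + (h, 0)).1 * x.1 + (p + (h, 0)).2 * x.2
          = x.1 * h + (p.1 * x.1 + p.2 * x.2) := by
        simp only [Prod.fst_add, Prod.snd_add]; ring
      rw [e, hχ.mul]
      ring
    · obtain ⟨h, h1, h2⟩ := detect_small hχ hx
      refine integral_eq_zero_of_translate ν (0, h) _ h2 fun p => ?_
      rw [hinv p (0, h) (by simp) h1]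
      have e : (p + (0, h)).1 * x.1 + (p + (0, h)).2 * x.2
          = x.2 * h + (p.1 * x.1 + p.2 * x.2) := by
        simp only [Prod.fst_add, Prod.snd_add]; ring
      rw [e, hχ.mul]
      ring

theorem mem_qpItv {l a : ℕ} {ξ : ℚ_[q]} :
    ξ ∈ qpItv q l a ↔ ‖ξ - (a : ℚ_[q])‖ ≤ ((q : ℝ) ^ l)⁻¹ := by
  unfold qpItv
  rw [Set.mem_ofPred_eq, zpow_neg, zpow_natCast]

theorem qpItv_inv {l a K : ℕ} (hK : l ≤ K) {ξ h : ℚ_[q]} (hh : ‖h‖ ≤ ((q : ℝ) ^ K)⁻¹) :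
    ξ + h ∈ qpItv q l a ↔ ξ ∈ qpItv q l a := by
  have hq := q_one_lt (q := q)
  have hh' : ‖h‖ ≤ ((q : ℝ) ^ l)⁻¹ := hh.trans (by gcongr; exact hq.le)
  rw [mem_qpItv, mem_qpItv]
  constructor
  · intro h1
    have e : ξ - (a : ℚ_[q]) = (ξ + h - (a : ℚ_[q])) + -h := by ring
    rw [e]
    exact nonarch2 h1 (by rwa [norm_neg])
  · intro h1
    have e : ξ + h - (a : ℚ_[q]) = (ξ - (a : ℚ_[q])) + h := by ring
    rw [e]
    exact nonarch2 h1 hh'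

theorem exists_center {ξ : ℚ_[q]} (hξ : ‖ξ‖ ≤ 1) (L : ℕ) :
    ∃ b, b < q ^ L ∧ ξ ∈ qpItv q L b := by
  set y : ℤ_[q] := ⟨ξ, hξ⟩
  refine ⟨y.appr L, y.appr_lt L, ?_⟩
  have := ((y - y.appr L).norm_le_pow_iff_mem_span_pow L).mpr (y.appr_spec L)
  exact this

theorem center_unique {ξ : ℚ_[q]} {L b b' : ℕ} (hb : b < q ^ L) (hb' : b' < q ^ L)
    (h : ξ ∈ qpItv q L b) (h' : ξ ∈ qpItv q L b') : b = b' := by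
  by_contra hne
  have h1 := norm_sub_gt_of_ne (q := q) hb hb' hne
  rw [mem_qpItv] at h h'
  have e : (b' : ℚ_[q]) - (b : ℚ_[q]) = (ξ - (b : ℚ_[q])) + -(ξ - (b' : ℚ_[q])) := by ring
  have := nonarch2 h (y := -(ξ - (b' : ℚ_[q]))) (by rwa [norm_neg])
  rw [← e] at this
  linarith

theorem center_mod {ξ : ℚ_[q]} {L l a b : ℕ} (hl : l ≤ L) (ha : a < q ^ l)
    (h : ξ ∈ qpItv q L b) : ξ ∈ qpItv q l a ↔ b % q ^ l = a := by
  have hq := q_one_lt (q := q)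
  rw [mem_qpItv] at h
  have h' : ‖ξ - (b : ℚ_[q])‖ ≤ ((q : ℝ) ^ l)⁻¹ := h.trans (by gcongr; exact hq.le)
  have e0 := norm_sub_le_iff (q := q) a b l
  rw [Nat.mod_eq_of_lt ha] at e0
  rw [← e0, mem_qpItv]
  constructor
  · intro h1
    have e : (b : ℚ_[q]) - (a : ℚ_[q]) = (ξ - (a : ℚ_[q])) + -(ξ - (b : ℚ_[q])) := by ring
    rw [e]
    exact nonarch2 h1 (by rwa [norm_neg])
  · intro h1
    have e : ξ - (a : ℚ_[q]) = (ξ - (b : ℚ_[q])) + ((b : ℚ_[q]) - (a : ℚ_[q])) := by ring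
    rw [e]
    exact nonarch2 h' h1

open scoped Classical in
/-- Frequency cutoff to a strip. -/
noncomputable def qcut (g : ℚ_[q] × ℚ_[q] → ℂ) (l a : ℕ) (p : ℚ_[q] × ℚ_[q]) : ℂ :=
  if p.1 ∈ qpItv q l a then g p else 0

theorem qcut_ne {g : ℚ_[q] × ℚ_[q] → ℂ} {l a : ℕ} {p : ℚ_[q] × ℚ_[q]} (h : qcut g l a p ≠ 0) :
    p.1 ∈ qpItv q l a ∧ g p ≠ 0 := by
  unfold qcut at h
  split_ifs at h with h1
  · exact ⟨h1, h⟩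
  · exact absurd rfl h

theorem qcut_inv {g : ℚ_[q] × ℚ_[q] → ℂ} {K l a : ℕ} (hl : l ≤ K)
    (hinv : ∀ x t : ℚ_[q] × ℚ_[q], ‖t.1‖ ≤ ((q : ℝ) ^ K)⁻¹ → ‖t.2‖ ≤ ((q : ℝ) ^ K)⁻¹ →
      g (x + t) = g x) (x t : ℚ_[q] × ℚ_[q]) (h1 : ‖t.1‖ ≤ ((q : ℝ) ^ K)⁻¹)
    (h2 : ‖t.2‖ ≤ ((q : ℝ) ^ K)⁻¹) : qcut g l a (x + t) = qcut g l a x := by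
  unfold qcut
  have h3 : (x + t).1 ∈ qpItv q l a ↔ x.1 ∈ qpItv q l a := qpItv_inv hl h1
  rw [hinv x t h1 h2]
  by_cases h4 : x.1 ∈ qpItv q l a
  · rw [if_pos h4, if_pos (h3.2 h4)]
  · rw [if_neg h4, if_neg (fun h => h4 (h3.1 h))]

theorem qcut_sum {g : ℚ_[q] × ℚ_[q] → ℂ} {L l a : ℕ} (hl : l ≤ L) (ha : a < q ^ l)
    (hs : ∀ p : ℚ_[q] × ℚ_[q], ¬ (‖p.1‖ ≤ 1 ∧ ‖p.2‖ ≤ 1) → g p = 0) (p : ℚ_[q] × ℚ_[q]) :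
    qcut g l a p = ∑ b ∈ qdesc q L l a, qcut g L b p := by
  classical
  by_cases hp : ‖p.1‖ ≤ 1 ∧ ‖p.2‖ ≤ 1
  · obtain ⟨b0, hb0, hb0'⟩ := exists_center hp.1 L
    have h1 : ∀ b ∈ Finset.range (q ^ L), qcut g L b p = if b = b0 then g p else 0 := by
      intro b hb
      unfold qcut
      have : p.1 ∈ qpItv q L b ↔ b = b0 := by
        constructor
        · intro h
          exact center_unique (Finset.mem_range.1 hb) hb0 h hb0'
        · rintro rfl; exact hb0'
      simp only [this]
    have h2 : ∀ b ∈ qdesc q L l a, qcut g L b p = if b = b0 then g p else 0 :=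
      fun b hb => h1 b (Finset.mem_filter.1 hb).1
    rw [Finset.sum_congr rfl h2, Finset.sum_ite_eq']
    unfold qcut
    simp only [center_mod hl ha hb0', qdesc, Finset.mem_filter, Finset.mem_range, hb0, true_and]
  · have h0 := hs p hp
    simp [qcut, h0]

theorem qInv_sum (hχ : QChr q χ) {g : ℚ_[q] × ℚ_[q] → ℂ} {K L l a : ℕ} (hl : l ≤ L) (hK : L ≤ K)
    (ha : a < q ^ l)
    (hinv : ∀ x t : ℚ_[q] × ℚ_[q], ‖t.1‖ ≤ ((q : ℝ) ^ K)⁻¹ → ‖t.2‖ ≤ ((q : ℝ) ^ K)⁻¹ →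
      g (x + t) = g x)
    (hs : ∀ p : ℚ_[q] × ℚ_[q], ¬ (‖p.1‖ ≤ 1 ∧ ‖p.2‖ ≤ 1) → g p = 0) (x : ℚ_[q] × ℚ_[q]) :
    qInv ν χ (qcut g l a) x = qFF (fun b => qInv ν χ (qcut g L b)) L l a x := by
  have hq := q_pos (q := q)
  unfold qFF qInv
  rw [← integral_finsetSum]
  · refine integral_congr_ae (Filter.Eventually.of_forall fun p => ?_)
    simp only
    rw [qcut_sum hl ha hs, Finset.sum_mul]
  · intro b _
    refine qInv_integrable ν hχ (nice_of_inv (c := ((q : ℝ) ^ K)⁻¹) (d := 1) (by positivity)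
      (qcut_inv hK hinv) fun p hp => ?_) x
    simp [qcut, hs p hp]

theorem qInv_sys (hχ : QChr q χ) {g : ℚ_[q] × ℚ_[q] → ℂ} {K L : ℕ} (hK : L ≤ K)
    (hinv : ∀ x t : ℚ_[q] × ℚ_[q], ‖t.1‖ ≤ ((q : ℝ) ^ K)⁻¹ → ‖t.2‖ ≤ ((q : ℝ) ^ K)⁻¹ →
      g (x + t) = g x)
    (hs : ∀ p : ℚ_[q] × ℚ_[q], ¬ (‖p.1‖ ≤ 1 ∧ ‖p.2 - p.1 ^ 2‖ ≤ ((q : ℝ) ^ (2 * L))⁻¹) → g p = 0)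
    (hs1 : ∀ p : ℚ_[q] × ℚ_[q], ¬ (‖p.1‖ ≤ 1 ∧ ‖p.2‖ ≤ 1) → g p = 0) :
    QSys χ L (fun b => qInv ν χ (qcut g L b)) := by
  have hq := q_pos (q := q)
  have hQ : (0 : ℝ) < (q : ℝ) ^ L := by positivity
  refine ⟨fun b => qInv_nice ν hχ (qcut_inv hK hinv) fun p hp => ?_, fun b => ?_⟩
  · simp [qcut, hs1 p hp]
  · intro x t h1 h2
    refine qInv_shift ν hχ x t _ fun p hp => ?_
    obtain ⟨hp1, hp2⟩ := qcut_ne hp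
    rw [mem_qpItv] at hp1
    have hp3 : ‖p.1‖ ≤ 1 ∧ ‖p.2 - p.1 ^ 2‖ ≤ ((q : ℝ) ^ (2 * L))⁻¹ := by
      by_contra hcon
      exact hp2 (hs p hcon)
    have e : p.1 * t.1 + p.2 * t.2 - ((b : ℚ_[q]) * t.1 + (b : ℚ_[q]) ^ 2 * t.2)
        = (p.1 - (b : ℚ_[q])) * (t.1 + 2 * (b : ℚ_[q]) * t.2)
          + ((p.2 - p.1 ^ 2) + (p.1 - (b : ℚ_[q])) ^ 2) * t.2 := by ring
    rw [e]
    apply nonarch2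
    · rw [norm_mul]
      calc _ ≤ ((q : ℝ) ^ L)⁻¹ * (q : ℝ) ^ L := by gcongr
        _ = 1 := inv_mul_cancel₀ hQ.ne'
    · rw [norm_mul]
      calc _ ≤ ((q : ℝ) ^ (2 * L))⁻¹ * (q : ℝ) ^ (2 * L) := by
            gcongr
            apply nonarch2 hp3.2
            rw [norm_pow, mul_comm 2 L, pow_mul, ← inv_pow]
            gcongr
        _ = 1 := inv_mul_cancel₀ (by positivity)

variable (μ : Measure ℚ_[q]) [μ.IsAddHaarMeasure] [SigmaFinite μ]

theorem qpProj_eq (f : ℚ_[q] × ℚ_[q] → ℂ) (l a : ℕ) (x : ℚ_[q] × ℚ_[q]) :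
    qpProj q μ χ f (qpItv q l a) x = qInv (μ.prod μ) χ (qcut (qpFourier q μ χ f) l a) x := by
  classical
  have hm : MeasurableSet (qpItv q l a ×ˢ (Set.univ : Set ℚ_[q])) := by
    refine MeasurableSet.prod (IsClosed.measurableSet ?_) MeasurableSet.univ
    unfold qpItv
    exact isClosed_le (by fun_prop) continuous_const
  unfold qpProj qInv
  rw [← integral_indicator hm]
  refine integral_congr_ae (Filter.Eventually.of_forall fun p => ?_)
  simp only [Set.indicator, Set.mem_prod, Set.mem_univ, and_true, qcut]
  split_ifs
  · rfl
  · ring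

theorem qpFourier_inv (hχ : QChr q χ) {f : ℚ_[q] × ℚ_[q] → ℂ} (hf : HasCompactSupport f) (L : ℕ) :
    ∃ K, L ≤ K ∧ ∀ x t : ℚ_[q] × ℚ_[q], ‖t.1‖ ≤ ((q : ℝ) ^ K)⁻¹ → ‖t.2‖ ≤ ((q : ℝ) ^ K)⁻¹ →
      qpFourier q μ χ f (x + t) = qpFourier q μ χ f x := by
  have hq1 := q_one_lt (q := q)
  obtain ⟨B, hB⟩ := (IsCompact.isBounded hf).exists_norm_le
  obtain ⟨K0, hK0⟩ := pow_unbounded_of_one_lt B hq1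
  refine ⟨max K0 L, le_max_right _ _, fun x t h1 h2 => ?_⟩
  set K := max K0 L
  have hK : B ≤ (q : ℝ) ^ K := hK0.le.trans (pow_le_pow_right₀ hq1.le (le_max_left _ _))
  have hQ : (0 : ℝ) < (q : ℝ) ^ K := by positivity
  unfold qpFourier
  refine integral_congr_ae (Filter.Eventually.of_forall fun p => ?_)
  simp only
  by_cases hp : f p = 0
  · rw [hp]; ring
  · have hpB : ‖p‖ ≤ (q : ℝ) ^ K := (hB p (subset_tsupport f hp)).trans hK
    congr 1
    apply hχ.congr
    have e : -((x + t).1 * p.1 + (x + t).2 * p.2) - -(x.1 * p.1 + x.2 * p.2)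
        = -(t.1 * p.1 + t.2 * p.2) := by
      simp only [Prod.fst_add, Prod.snd_add]; ring
    rw [e, norm_neg]
    apply nonarch2
    · rw [norm_mul]
      calc _ ≤ ((q : ℝ) ^ K)⁻¹ * (q : ℝ) ^ K := by
            gcongr
            exact (norm_fst_le p).trans hpB
        _ = 1 := inv_mul_cancel₀ hQ.ne'
    · rw [norm_mul]
      calc _ ≤ ((q : ℝ) ^ K)⁻¹ * (q : ℝ) ^ K := by
            gcongr
            exact (norm_snd_le p).trans hpB
        _ = 1 := inv_mul_cancel₀ hQ.ne'

theorem main_est (hq2 : q ≠ 2) (hχ : QChr q χ) {f : ℚ_[q] × ℚ_[q] → ℂ}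
    (hf : HasCompactSupport f) {L s : ℕ} (hL : 1 ≤ L) (hs : s ≤ L)
    (hsupp : ∀ p : ℚ_[q] × ℚ_[q], ¬ (‖p.1‖ ≤ 1 ∧ ‖p.2 - p.1 ^ 2‖ ≤ ((q : ℝ) ^ (2 * L))⁻¹) →
      qpFourier q μ χ f p = 0) :
    ∫ x, (⨆ b ∈ Finset.range (q ^ s), ⨆ b' ∈ Finset.range (q ^ s), ⨆ _ : b ≠ b',
                ‖qpProj q μ χ f (qpItv q s b) x *
                  qpProj q μ χ f (qpItv q s b') x‖ ^ 3) ∂(μ.prod μ)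
      ≤ 100000000 * (q : ℝ) ^ 15 * (L : ℝ) ^ 8 * (q : ℝ) ^ s *
        (∑ b ∈ Finset.range (q ^ L), (⨆ x, ‖qpProj q μ χ f (qpItv q L b) x‖) ^ 2) ^ 2 *
        ∑ b ∈ Finset.range (q ^ L), ∫ x, ‖qpProj q μ χ f (qpItv q L b) x‖ ^ 2 ∂(μ.prod μ) := by
  have hq1 := q_one_lt (q := q)
  obtain ⟨K, hK, hinv⟩ := qpFourier_inv μ hχ hf L
  set g := qpFourier q μ χ f with hg
  have hs1 : ∀ p : ℚ_[q] × ℚ_[q], ¬ (‖p.1‖ ≤ 1 ∧ ‖p.2‖ ≤ 1) → g p = 0 := by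
    intro p hp
    refine hsupp p fun h => hp ⟨h.1, ?_⟩
    have e : p.2 = (p.2 - p.1 ^ 2) + p.1 ^ 2 := by ring
    rw [e]
    apply nonarch2
    · exact h.2.trans (inv_le_one_of_one_le₀ (one_le_pow₀ hq1.le))
    · rw [norm_pow]
      exact pow_le_one₀ (norm_nonneg _) h.1
  have hF := qInv_sys (μ.prod μ) hχ hK hinv hsupp hs1
  have hsum : ∀ a, a < q ^ s → ∀ x, qpProj q μ χ f (qpItv q s a) x
      = qFF (fun b => qInv (μ.prod μ) χ (qcut g L b)) L s a x := fun a ha x => by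
    rw [qpProj_eq, qInv_sum (μ.prod μ) hχ hs hK ha hinv hs1]
  have htop : ∀ b x, qpProj q μ χ f (qpItv q L b) x = qInv (μ.prod μ) χ (qcut g L b) x :=
    fun b x => qpProj_eq μ f L b x
  simp only [htop]
  set F : ℕ → ℚ_[q] × ℚ_[q] → ℂ := fun b => qInv (μ.prod μ) χ (qcut g L b) with hFdef
  have hGx : ∀ x, ∑ b ∈ Finset.range (q ^ L), ‖F b x‖ ^ 2
      ≤ ∑ b ∈ Finset.range (q ^ L), (⨆ x, ‖F b x‖) ^ 2 := by
    intro x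
    refine Finset.sum_le_sum fun b _ => ?_
    gcongr
    obtain ⟨C, hC⟩ := (hF.nice b).2.exists_bound_of_continuous (hF.nice b).1.continuous
    exact le_ciSup (f := fun x => ‖F b x‖) ⟨C, by rintro _ ⟨y, rfl⟩; exact hC y⟩ x
  have hp := pairs_final (μ.prod μ) hq2 hχ hF hL hGx hs
  refine le_trans ?_ hp
  have n3 : ∀ a a', Integrable (fun x => ‖qFF F L s a x * qFF F L s a' x‖ ^ 3) (μ.prod μ) :=
    fun a a' => (((qFF_nice hF s a).mul (qFF_nice hF s a')).npow (by norm_num)).int _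
  have n2 : ∀ a ∈ Finset.range (q ^ s), ∀ a' ∈ Finset.range (q ^ s), Integrable (fun x =>
      if a ≠ a' then ‖qFF F L s a x * qFF F L s a' x‖ ^ 3 else 0) (μ.prod μ) := by
    intro a _ a' _
    by_cases h : a ≠ a'
    · simp only [if_pos h]; exact n3 a a'
    · simp only [if_neg h]; exact integrable_zero _ _ _
  have n1 : ∀ a ∈ Finset.range (q ^ s), Integrable (fun x => ∑ a' ∈ Finset.range (q ^ s),
      if a ≠ a' then ‖qFF F L s a x * qFF F L s a' x‖ ^ 3 else 0) (μ.prod μ) := fun a ha =>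
    integrable_finsetSum _ (n2 a ha)
  have e : ∑ a ∈ Finset.range (q ^ s), ∑ a' ∈ Finset.range (q ^ s),
      (if a ≠ a' then ∫ x, ‖qFF F L s a x * qFF F L s a' x‖ ^ 3 ∂(μ.prod μ) else 0)
      = ∫ x, (∑ a ∈ Finset.range (q ^ s), ∑ a' ∈ Finset.range (q ^ s),
        if a ≠ a' then ‖qFF F L s a x * qFF F L s a' x‖ ^ 3 else 0) ∂(μ.prod μ) := by
    rw [integral_finsetSum _ n1]
    refine Finset.sum_congr rfl fun a ha => ?_
    rw [integral_finsetSum _ (n2 a ha)]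
    refine Finset.sum_congr rfl fun a' _ => ?_
    split_ifs
    · rfl
    · simp
  rw [e]
  refine integral_mono_of_nonneg (Filter.Eventually.of_forall fun x => ?_)
    (integrable_finsetSum _ n1) (Filter.Eventually.of_forall fun x => ?_)
  · exact Real.iSup_nonneg fun b => Real.iSup_nonneg fun _ => Real.iSup_nonneg fun b' =>
      Real.iSup_nonneg fun _ => Real.iSup_nonneg fun _ => by positivity
  · have t0 : ∀ a ∈ Finset.range (q ^ s), ∀ a' ∈ Finset.range (q ^ s),
        0 ≤ if a ≠ a' then ‖qFF F L s a x * qFF F L s a' x‖ ^ 3 else 0 := by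
      intro a _ a' _
      split_ifs <;> positivity
    have t1 : ∀ a ∈ Finset.range (q ^ s), 0 ≤ ∑ a' ∈ Finset.range (q ^ s),
        if a ≠ a' then ‖qFF F L s a x * qFF F L s a' x‖ ^ 3 else 0 := fun a ha =>
      Finset.sum_nonneg (t0 a ha)
    have t2 := Finset.sum_nonneg t1
    refine Real.iSup_le (fun b => Real.iSup_le (fun hb => Real.iSup_le (fun b' =>
      Real.iSup_le (fun hb' => Real.iSup_le (fun hbb => ?_) t2) t2) t2) t2) t2
    rw [hsum b (Finset.mem_range.1 hb), hsum b' (Finset.mem_range.1 hb')]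
    have s1 := Finset.single_le_sum (t0 b hb) hb'
    have s2 := Finset.single_le_sum t1 hb
    simp only [if_pos hbb] at s1
    exact s1.trans s2

end fourier

/-- **Rescaled bilinear estimate (Proposition 5.2).** For `J ∈ {1,…,N}` and Schwartz `f` with
Fourier support in `Ξ_{1/R_J}`,
`∫ max_{τ₁ ≠ τ₁'} |f_{τ₁} f_{τ₁'}|³ ≤ C (log R)^{9+6ε} (∑_{τ_J} ‖f_{τ_J}‖_∞²)² (∑_{τ_J} ∫ |f_{τ_J}|²)`. -/
theorem bilinear_estimate_rescaled (q : ℕ) [Fact q.Prime] (hq2 : q ≠ 2)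
    (μ : Measure ℚ_[q]) [μ.IsAddHaarMeasure] [SigmaFinite μ]
    (hμ : μ {x : ℚ_[q] | ‖x‖ ≤ 1} = 1)
    (χ : ℚ_[q] → ℂ)
    (hχ_mul : ∀ x y : ℚ_[q], χ (x + y) = χ x * χ y)
    (hχ_norm : ∀ x : ℚ_[q], ‖χ x‖ = 1)
    (hχ_triv : ∀ x : ℚ_[q], ‖x‖ ≤ 1 → χ x = 1)
    (hχ_nontriv : ∃ x : ℚ_[q], ‖x‖ ≤ (q : ℝ) ∧ χ x ≠ 1)
    (ε : ℝ) (hε : 0 < ε) (hε1 : ε < 1) :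
    ∃ C : ℝ, 0 < C ∧ ∃ R₀ : ℕ, ∀ A : ℕ, 1 / ε ≤ (A : ℝ) → (A : ℝ) ≤ 2 / ε →
      ∀ m : ℕ, R₀ ≤ q ^ (2 * m) →
      ∀ r : ℕ, 4 ∣ r →
        (q : ℝ) ^ ((q : ℝ) ^ ((A : ℝ) * ((r : ℝ) - 4))) ≤ (q : ℝ) ^ (2 * m) →
        ((q : ℝ) ^ (2 * m) : ℝ) < (q : ℝ) ^ ((q : ℝ) ^ ((A : ℝ) * (r : ℝ))) →
      ∀ N : ℕ, q ^ (N * r) ≤ q ^ (2 * m) → q ^ (2 * m) < q ^ ((N + 1) * r) →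
      ∀ J : ℕ, 1 ≤ J → J ≤ N →
      ∀ f : ℚ_[q] × ℚ_[q] → ℂ, IsLocallyConstant f → HasCompactSupport f →
      (∀ p : ℚ_[q] × ℚ_[q],
        ¬ (‖p.1‖ ≤ 1 ∧ ‖p.2 - p.1 ^ 2‖ ≤ (q : ℝ) ^ (-((J * r : ℕ) : ℤ))) →
        qpFourier q μ χ f p = 0) →
      ∫ x, (⨆ b ∈ Finset.range (q ^ (r / 2)),
              ⨆ b' ∈ Finset.range (q ^ (r / 2)), ⨆ _ : b ≠ b',
                ‖qpProj q μ χ f (qpItv q (r / 2) b) x *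
                  qpProj q μ χ f (qpItv q (r / 2) b') x‖ ^ 3) ∂(μ.prod μ)
        ≤ C * (Real.log ((q : ℝ) ^ (2 * m))) ^ ((9 : ℝ) + 6 * ε) *
            (∑ b ∈ Finset.range (q ^ (J * (r / 2))),
                (⨆ x, ‖qpProj q μ χ f (qpItv q (J * (r / 2)) b) x‖) ^ 2) ^ 2 *
            ∑ b ∈ Finset.range (q ^ (J * (r / 2))),
              ∫ x, ‖qpProj q μ χ f (qpItv q (J * (r / 2)) b) x‖ ^ 2 ∂(μ.prod μ) := by
  have hq1 := q_one_lt (q := q)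
  have hq3 : (3 : ℝ) ≤ q := by
    have h2 := (Fact.out : q.Prime).two_le
    have : 3 ≤ q := by omega
    exact_mod_cast this
  have hqn : 1 < q := (Fact.out : q.Prime).one_lt
  refine ⟨100000000 * (q : ℝ) ^ 15 * (q : ℝ) ^ 4, by positivity, 0, ?_⟩
  intro A hA _ m _ r hr4 hR1 _ N hN1 hN2 J hJ1 hJN f _ hfc hsupp
  have hN1' : N * r ≤ 2 * m := (Nat.pow_le_pow_iff_right hqn).1 hN1
  have hN2' : 2 * m < (N + 1) * r := (Nat.pow_lt_pow_iff_right hqn).1 hN2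
  obtain ⟨k, rfl⟩ := hr4
  have hk : 1 ≤ k := by
    rcases Nat.eq_zero_or_pos k with h | h
    · subst h; simp at hN2'
    · exact h
  have hs2 : 4 * k / 2 = 2 * k := by omega
  rw [hs2]
  have hJr : J * (4 * k) ≤ 2 * m := (Nat.mul_le_mul_right _ hJN).trans hN1'
  have hLr : J * (4 * k) = 2 * (J * (2 * k)) := by ring
  have hsL : 2 * k ≤ J * (2 * k) := Nat.le_mul_of_pos_left _ hJ1
  have hLm : J * (2 * k) ≤ m := by omega
  have hL1 : 1 ≤ J * (2 * k) := by omega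
  have hm1 : 1 ≤ m := hL1.trans hLm
  have hmain := main_est μ hq2 (⟨hχ_mul, hχ_norm, hχ_triv, hχ_nontriv⟩ : QChr q χ) hfc hL1 hsL
    (fun p hp => hsupp p (by
      rw [hLr, zpow_neg, zpow_natCast]
      exact hp))
  refine hmain.trans ?_
  have hlogq : 1 ≤ Real.log q := by
    rw [Real.le_log_iff_exp_le (by positivity)]
    exact (Real.exp_one_lt_d9.le.trans (by norm_num)).trans hq3
  have hm1' : (1 : ℝ) ≤ m := by exact_mod_cast hm1
  set Y : ℝ := Real.log ((q : ℝ) ^ (2 * m)) with hY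
  have hYm : (2 : ℝ) * m ≤ Y := by
    rw [hY, Real.log_pow]
    push_cast
    nlinarith
  have hY1 : 1 ≤ Y := by linarith
  have hL8 : ((J * (2 * k) : ℕ) : ℝ) ^ 8 ≤ Y ^ 8 := by
    have : ((J * (2 * k) : ℕ) : ℝ) ≤ m := by exact_mod_cast hLm
    exact pow_le_pow_left₀ (by positivity) (by linarith) 8
  have hR2 : (q : ℝ) ^ ((A : ℝ) * (((4 * k : ℕ) : ℝ) - 4)) ≤ 2 * m := by
    rw [← Real.rpow_natCast (q : ℝ) (2 * m), Real.rpow_le_rpow_left_iff hq1] at hR1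
    exact_mod_cast hR1
  have hk1 : (1 : ℝ) ≤ k := by exact_mod_cast hk
  have hs : (q : ℝ) ^ (2 * k) ≤ (q : ℝ) ^ 4 * Y ^ ε := by
    have e1 : (q : ℝ) ^ (((4 * k : ℕ) : ℝ) - 4) ≤ Y ^ ε := by
      have h1 : (q : ℝ) ^ (((4 * k : ℕ) : ℝ) - 4)
          ≤ ((q : ℝ) ^ ((A : ℝ) * (((4 * k : ℕ) : ℝ) - 4))) ^ ε := by
        rw [← Real.rpow_mul (by positivity)]
        refine Real.rpow_le_rpow_of_exponent_le hq1.le ?_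
        have h2 : 1 ≤ (A : ℝ) * ε := by
          rw [div_le_iff₀ hε] at hA; exact hA
        have h3 : (0 : ℝ) ≤ ((4 * k : ℕ) : ℝ) - 4 := by push_cast; linarith
        nlinarith
      refine h1.trans (Real.rpow_le_rpow (by positivity) (hR2.trans hYm) hε.le)
    have e2 : (q : ℝ) ^ (2 * k) ≤ (q : ℝ) ^ 4 * (q : ℝ) ^ (((4 * k : ℕ) : ℝ) - 4) := by
      rw [← Real.rpow_natCast, ← Real.rpow_natCast, ← Real.rpow_add (by positivity)]
      refine Real.rpow_le_rpow_of_exponent_le hq1.le ?_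
      push_cast
      linarith
    exact e2.trans (by gcongr)
  have hYp : Y ^ 8 * Y ^ ε ≤ Y ^ ((9 : ℝ) + 6 * ε) := by
    rw [← Real.rpow_natCast, ← Real.rpow_add (by positivity)]
    refine Real.rpow_le_rpow_of_exponent_le hY1 ?_
    push_cast
    linarith
  have hc : 100000000 * (q : ℝ) ^ 15 * ((J * (2 * k) : ℕ) : ℝ) ^ 8 * (q : ℝ) ^ (2 * k)
      ≤ 100000000 * (q : ℝ) ^ 15 * (q : ℝ) ^ 4 * Y ^ ((9 : ℝ) + 6 * ε) := by
    calc 100000000 * (q : ℝ) ^ 15 * ((J * (2 * k) : ℕ) : ℝ) ^ 8 * (q : ℝ) ^ (2 * k)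
        ≤ 100000000 * (q : ℝ) ^ 15 * Y ^ 8 * ((q : ℝ) ^ 4 * Y ^ ε) := by gcongr
      _ = 100000000 * (q : ℝ) ^ 15 * (q : ℝ) ^ 4 * (Y ^ 8 * Y ^ ε) := by ring
      _ ≤ _ := by gcongr
  refine mul_le_mul_of_nonneg_right (mul_le_mul_of_nonneg_right hc (by positivity)) ?_
  exact Finset.sum_nonneg fun b _ => integral_nonneg fun x => by positivity
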